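/- arXiv:2511.15519 — 4 statements merged into one kernel-verified Lean document; each statement's English description precedes it below -/
import Mathlib

section
/- Let τ ∈ ℂ with Im τ > 0 and let x, y ∈ ℂ. Then C(x,y|τ) − C(−x,−y|τ) = (−i/η(τ))·θ₁(x|τ)·θ₁(y|τ)·θ₁(x+y|τ). -/
open Complex

/-- The Jacobi theta function θ₁(z|τ). -/
noncomputable def theta1 (z τ : ℂ) : ℂ :=
  -Complex.I * ∑' n : ℤ, (-1 : ℂ) ^ n *
    Complex.exp (Real.pi * Complex.I * τ * (2 * (n : ℂ) + 1) ^ 2 / 4) *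
    Complex.exp ((2 * (n : ℂ) + 1) * Complex.I * z)

/-- The Dedekind eta function. -/
noncomputable def dedekindEta (τ : ℂ) : ℂ :=
  Complex.exp (Real.pi * Complex.I * τ / 12) *
    ∏' k : ℕ, (1 - Complex.exp (2 * Real.pi * Complex.I * ((k : ℂ) + 1) * τ))

/-- The theta series C(x,y|τ). -/
noncomputable def Cfun (x y τ : ℂ) : ℂ :=
  Complex.exp (2 * Complex.I * (x + y)) * ∑' k : ℤ, ∑' l : ℤ,
    Complex.exp (2 * Complex.I * Real.pi * τ *
      ((k : ℂ) ^ 2 + (k : ℂ) * (l : ℂ) + (l : ℂ) ^ 2 + (k : ℂ) + (l : ℂ) + 1 / 3)) *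
    Complex.exp (2 * Complex.I * x * (2 * (l : ℂ) + (k : ℂ))) *
    Complex.exp (2 * Complex.I * y * (2 * (k : ℂ) + (l : ℂ)))

open Filter Topology in
/-- Pentagonal number theorem for complex numbers in the open unit disc. -/
theorem pentagonal_complex (x : ℂ) (hx : ‖x‖ < 1) :
    ∏' n : ℕ, (1 - x ^ (n + 1)) = ∑' j : ℤ, (-1 : ℂ) ^ j * x ^ pentagonal j := by
  set r := ‖x‖ with hr
  have hr0 : 0 ≤ r := norm_nonneg x
  set M : ℝ := Real.exp (1 - r)⁻¹ with hM
  have hprod : ∀ k n : ℕ, ‖∏ i ∈ Finset.range (n + 1), (1 - x ^ (k + i + 1))‖ ≤ M := by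
    intro k n
    rw [norm_prod]
    calc ∏ i ∈ Finset.range (n + 1), ‖1 - x ^ (k + i + 1)‖
        ≤ ∏ i ∈ Finset.range (n + 1), Real.exp (r ^ i) := by
          apply Finset.prod_le_prod
          · intros; positivity
          · intro i _
            calc ‖1 - x ^ (k + i + 1)‖ ≤ ‖(1 : ℂ)‖ + ‖x ^ (k + i + 1)‖ := norm_sub_le _ _
              _ = 1 + r ^ (k + i + 1) := by simp [hr]
              _ ≤ 1 + r ^ i := by
                gcongr 1 + ?_
                exact pow_le_pow_of_le_one hr0 hx.le (by omega)
              _ ≤ Real.exp (r ^ i) := by rw [add_comm]; exact Real.add_one_le_exp _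
      _ = Real.exp (∑ i ∈ Finset.range (n + 1), r ^ i) := (Real.exp_sum _ _).symm
      _ ≤ M := by
          rw [hM, Real.exp_le_exp, ← tsum_geometric_of_lt_one hr0 hx]
          exact (summable_geometric_of_lt_one hr0 hx).sum_le_tsum _ (fun _ _ => by positivity)
  have hterm : ∀ k n : ℕ,
      ‖x ^ ((k + 1) * n) * ∏ i ∈ Finset.range (n + 1), (1 - x ^ (k + i + 1))‖ ≤ r ^ n * M := by
    intro k n
    rw [norm_mul, norm_pow]
    exact mul_le_mul (pow_le_pow_of_le_one hr0 hx.le (Nat.le_mul_of_pos_left n k.succ_pos))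
      (hprod k n) (norm_nonneg _) (by positivity)
  have hgs : Summable fun n : ℕ => r ^ n * M := (summable_geometric_of_lt_one hr0 hx).mul_right M
  have hpent : Summable fun j : ℤ => x ^ pentagonal j :=
    (summable_geometric_of_norm_lt_one hx).comp_injective pentagonal_injective
  have hZ : Summable fun j : ℤ => (-1 : ℂ) ^ j * x ^ pentagonal (-j) := by
    have h1 : Summable fun j : ℤ => ‖x ^ pentagonal (-j)‖ :=
      (hpent.comp_injective neg_injective).norm
    exact Summable.of_norm (by simpa using h1)
  have hN1 : Summable fun k : ℕ => (-1 : ℂ) ^ k * x ^ pentagonal (-k) := by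
    have := hZ.comp_injective Nat.cast_injective
    simpa [Function.comp_def] using this
  have hpar : ∀ k : ℕ, (-1 : ℂ) ^ (-((k : ℤ) + 1)) = - (-1) ^ k := by
    intro k
    rw [zpow_neg, ← inv_zpow, zpow_add₀ (by norm_num)]
    norm_num
  have hN2 : Summable fun k : ℕ => (-1 : ℂ) ^ k * x ^ pentagonal (k + 1) := by
    have := (hZ.comp_injective (i := fun k : ℕ => -((k : ℤ) + 1)) (fun a b h => by simpa using h)).neg
    simpa only [Function.comp_def, hpar, neg_mul, neg_neg] using this
  rw [Pentagonal.tprod_one_sub_pow]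
  · rw [← (Equiv.neg ℤ).tsum_eq]
    have e : ∀ j : ℤ, (-1 : ℂ) ^ (Equiv.neg ℤ j) * x ^ pentagonal (Equiv.neg ℤ j)
        = (-1 : ℂ) ^ j * x ^ pentagonal (-j) := by
      intro j
      simp [← inv_zpow]
    simp_rw [e]
    rw [tsum_of_nat_of_neg_add_one (f := fun j : ℤ => (-1 : ℂ) ^ j * x ^ pentagonal (-j))
      (by simpa using hN1) (by simpa only [hpar, neg_mul, neg_neg] using hN2.neg)]
    simp only [hpar, neg_neg, zpow_natCast, neg_mul]
    rw [tsum_neg, ← sub_eq_add_neg, ← hN1.tsum_sub hN2]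
    simp only [mul_sub]
  · exact tendsto_pow_atTop_nhds_zero_of_norm_lt_one hx
  · intro k
    exact Summable.of_norm_bounded hgs (hterm k)
  · intro k
    apply multipliable_one_add_of_summable (f := fun n => -x ^ (n + k + 1))
    have := (summable_nat_add_iff (k + 1)).mpr (summable_geometric_of_lt_one hr0 hx)
    simpa [add_assoc, hr] using this
  · simpa only [mul_sub] using hN1.sub hN2
  · apply squeeze_zero_norm (a := fun k : ℕ => r ^ k * ∑' n : ℕ, r ^ n * M)
    · intro k
      rw [norm_mul, norm_mul, norm_pow, norm_pow, norm_neg, norm_one, one_pow, one_mul]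
      refine mul_le_mul ?_ ?_ (norm_nonneg _) (by positivity)
      · apply pow_le_pow_of_le_one hr0 hx.le
        rw [Nat.le_div_iff_mul_le (by norm_num)]
        nlinarith
      · exact tsum_of_norm_bounded hgs.hasSum (hterm k)
    · simpa using (tendsto_pow_atTop_nhds_zero_of_lt_one hr0 hx).mul_const (∑' n : ℕ, r ^ n * M)

theorem norm_q_lt_one (τ : ℂ) (hτ : 0 < τ.im) : ‖cexp (2 * Real.pi * I * τ)‖ < 1 := by
  rw [Complex.norm_exp, Real.exp_lt_one_iff]
  have : (2 * Real.pi * I * τ).re = -(2 * Real.pi * τ.im) := by simp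
  rw [this]
  have := Real.pi_pos
  have : 0 < 2 * Real.pi * τ.im := by positivity
  linarith

theorem dedekindEta_ne_zero (τ : ℂ) (hτ : 0 < τ.im) : dedekindEta τ ≠ 0 := by
  have h := ModularForm.eta_ne_zero (z := τ) hτ
  unfold ModularForm.eta at h
  simp only [ModularForm.eta_q_eq_cexp] at h
  exact mul_ne_zero (exp_ne_zero _) (right_ne_zero_of_mul h)

theorem dedekindEta_eq_tsum (τ : ℂ) (hτ : 0 < τ.im) :
    dedekindEta τ = ∑' j : ℤ, (-1 : ℂ) ^ j *
      cexp (Real.pi * I * τ * (3 * ((j : ℂ) - 1 / 6) ^ 2)) := by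
  have h := pentagonal_complex _ (norm_q_lt_one τ hτ)
  have e : ∀ k : ℕ, cexp (2 * Real.pi * I * ((k : ℂ) + 1) * τ)
      = cexp (2 * Real.pi * I * τ) ^ (k + 1) := by
    intro k
    rw [← Complex.exp_nat_mul]
    congr 1
    push_cast
    ring
  unfold dedekindEta
  simp_rw [e]
  rw [h, ← tsum_mul_left]
  congr 1
  ext j
  rw [← Complex.exp_nat_mul, mul_left_comm, ← Complex.exp_add]
  congr 2
  have hp : (2 : ℂ) * (pentagonal j : ℂ) = j * (3 * j - 1) := by
    exact_mod_cast congrArg (Int.cast (R := ℂ)) (two_mul_natCast_pentagonal j)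
  linear_combination (Real.pi * I * τ) * hp

/-- The general term of the series of `θ₁`. -/
noncomputable def thTerm (z τ : ℂ) (n : ℤ) : ℂ :=
  (-1 : ℂ) ^ n * Complex.exp (Real.pi * Complex.I * τ * (2 * (n : ℂ) + 1) ^ 2 / 4) *
    Complex.exp ((2 * (n : ℂ) + 1) * Complex.I * z)

theorem summable_norm_thTerm (z τ : ℂ) (hτ : 0 < τ.im) :
    Summable fun n => ‖thTerm z τ n‖ := by
  have h := ((summable_jacobiTheta₂_term_iff (z / Real.pi + τ / 2) τ).mpr hτ).norm.mul_left
    ‖cexp (Real.pi * I * τ / 4 + I * z)‖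
  refine (summable_congr fun n => ?_).mpr h
  rw [thTerm, norm_mul, norm_mul, norm_zpow, norm_neg, norm_one, one_zpow, one_mul, ← norm_mul,
    ← norm_mul, jacobiTheta₂_term, ← Complex.exp_add, ← Complex.exp_add]
  congr 2
  have : (Real.pi : ℂ) ≠ 0 := by exact_mod_cast Real.pi_ne_zero
  field_simp
  ring

/-- The general term of the triple product in terms of the exponents `(A, B)` and `p`. -/
noncomputable def trTerm (x y τ : ℂ) (c : (ℤ × ℤ) × ℤ) : ℂ :=
  (-1 : ℂ) ^ (c.1.1 + c.1.2 + c.2) *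
    cexp (Real.pi * I * τ * (3 * ((c.2 : ℂ) + 1 / 2 - (c.1.1 + c.1.2) / 3) ^ 2)) *
    cexp (2 * Real.pi * I * τ * (((c.1.1 : ℂ) ^ 2 + c.1.2 ^ 2 - c.1.1 * c.1.2) / 3)
      + 2 * I * (c.1.1 * x + c.1.2 * y))

/-- Change of indices. -/
def trEquiv : (ℤ × ℤ) × ℤ ≃ (ℤ × ℤ) × ℤ where
  toFun c := ((c.1.1 - c.2 - 1, c.1.2 - c.2 - 1), c.2)
  invFun c := ((c.1.1 + c.2 + 1, c.1.2 + c.2 + 1), c.2)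
  left_inv c := by ext <;> simp <;> ring
  right_inv c := by ext <;> simp <;> ring

theorem trTerm_eq (x y τ : ℂ) (c : (ℤ × ℤ) × ℤ) :
    thTerm x τ (trEquiv c).1.1 * thTerm y τ (trEquiv c).1.2 * thTerm (x + y) τ (trEquiv c).2
      = trTerm x y τ c := by
  obtain ⟨⟨A, B⟩, p⟩ := c
  simp only [trEquiv, Equiv.coe_fn_mk, thTerm, trTerm]
  have hs : (-1 : ℂ) ^ (A - p - 1) * (-1 : ℂ) ^ (B - p - 1) * (-1 : ℂ) ^ p
      = (-1 : ℂ) ^ (A + B + p) := by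
    rw [← zpow_add₀ (by norm_num), ← zpow_add₀ (by norm_num),
      show A - p - 1 + (B - p - 1) + p = (A + B + p) + 2 * (-p - 1) by ring,
      zpow_add₀ (by norm_num), zpow_mul]
    norm_num
  rw [← hs]
  have he : ∀ a b c d e f : ℂ, ∀ u v : ℂ, a + b + c + d + e + f = u + v →
    cexp a * cexp b * cexp c * cexp d * cexp e * cexp f = cexp u * cexp v := by
    intro a b c d e f u v h
    simp only [← Complex.exp_add, h]
  rw [mul_assoc ((-1 : ℂ) ^ (A - p - 1) * (-1 : ℂ) ^ (B - p - 1) * (-1 : ℂ) ^ p),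
    ← he (Real.pi * Complex.I * τ * (2 * ((A - p - 1 : ℤ) : ℂ) + 1) ^ 2 / 4)
    ((2 * ((A - p - 1 : ℤ) : ℂ) + 1) * Complex.I * x)
    (Real.pi * Complex.I * τ * (2 * ((B - p - 1 : ℤ) : ℂ) + 1) ^ 2 / 4)
    ((2 * ((B - p - 1 : ℤ) : ℂ) + 1) * Complex.I * y)
    (Real.pi * Complex.I * τ * (2 * (p : ℂ) + 1) ^ 2 / 4)
    ((2 * (p : ℂ) + 1) * Complex.I * (x + y))]
  · ring
  · push_cast
    ring

/-- The coefficient sum. -/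
noncomputable def G (x y τ : ℂ) (c : ℤ × ℤ) : ℂ := ∑' p : ℤ, trTerm x y τ (c, p)

theorem triple (x y τ : ℂ) (hτ : 0 < τ.im) :
    Summable (G x y τ) ∧ (∑' n, thTerm x τ n) * (∑' n, thTerm y τ n) * (∑' n, thTerm (x + y) τ n)
      = ∑' c, G x y τ c := by
  have hx := summable_norm_thTerm x τ hτ
  have hy := summable_norm_thTerm y τ hτ
  have hz := summable_norm_thTerm (x + y) τ hτ
  have hxy := hx.mul_norm hy
  have hs : Summable (trTerm x y τ) := by
    have := (hxy.mul_norm hz).of_norm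
    rw [← trEquiv.summable_iff] at this
    simpa only [Function.comp_def, trTerm_eq] using this
  refine ⟨hs.prod, ?_⟩
  rw [tsum_mul_tsum_of_summable_norm hx hy, tsum_mul_tsum_of_summable_norm hxy hz,
    ← trEquiv.tsum_eq]
  simp only [trTerm_eq]
  exact hs.tsum_prod

theorem G_zero (x y τ : ℂ) (A B s : ℤ) (h : A + B = 3 * s) : G x y τ (A, B) = 0 := by
  have key : G x y τ (A, B) = - G x y τ (A, B) := by
    conv_lhs => rw [G, ← (Equiv.subLeft (2 * s - 1)).tsum_eq]
    rw [G, ← tsum_neg]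
    congr 1
    ext p
    have hc : (A : ℂ) + B = 3 * s := by exact_mod_cast h
    simp only [trTerm, Equiv.subLeft_apply, h, hc]
    have h1 : (-1 : ℂ) ^ (3 * s + (2 * s - 1 - p)) = -(-1 : ℂ) ^ (3 * s + p) := by
      rw [show 3 * s + (2 * s - 1 - p) = (3 * s + p) + 2 * (s - p - 1) + 1 by ring,
        zpow_add₀ (by norm_num), zpow_add₀ (by norm_num), zpow_mul]
      norm_num
    rw [h1, show (((2 * s - 1 - p : ℤ) : ℂ) + 1 / 2 - 3 * s / 3) ^ 2
      = ((p : ℂ) + 1 / 2 - 3 * s / 3) ^ 2 by push_cast; ring]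
    ring
  have := self_eq_neg.mp key
  exact this

/-- The general term of the series `C`, with the prefactor. -/
noncomputable def cTerm (x y τ : ℂ) (c : ℤ × ℤ) : ℂ :=
  Complex.exp (2 * Complex.I * (x + y)) * (Complex.exp (2 * Complex.I * Real.pi * τ *
      ((c.1 : ℂ) ^ 2 + (c.1 : ℂ) * (c.2 : ℂ) + (c.2 : ℂ) ^ 2 + (c.1 : ℂ) + (c.2 : ℂ) + 1 / 3)) *
    Complex.exp (2 * Complex.I * x * (2 * (c.2 : ℂ) + (c.1 : ℂ))) *
    Complex.exp (2 * Complex.I * y * (2 * (c.1 : ℂ) + (c.2 : ℂ))))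

/-- First family of exponents. -/
def e1 (c : ℤ × ℤ) : ℤ × ℤ := (2 * c.2 + c.1 + 1, 2 * c.1 + c.2 + 1)

/-- Second family of exponents. -/
def e2 (c : ℤ × ℤ) : ℤ × ℤ := (-(2 * c.2 + c.1 + 1), -(2 * c.1 + c.2 + 1))

theorem e1_inj : Function.Injective e1 := by
  rintro ⟨a, b⟩ ⟨c, d⟩ h
  simp only [e1, Prod.mk.injEq] at h ⊢
  omega

theorem e2_inj : Function.Injective e2 := by
  rintro ⟨a, b⟩ ⟨c, d⟩ h
  simp only [e2, Prod.mk.injEq] at h ⊢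
  omega

theorem G_e1 (x y τ : ℂ) (hτ : 0 < τ.im) (c : ℤ × ℤ) :
    G x y τ (e1 c) = dedekindEta τ * cTerm x y τ c := by
  obtain ⟨k, l⟩ := c
  rw [G, ← (Equiv.addLeft (k + l)).tsum_eq, dedekindEta_eq_tsum τ hτ, ← tsum_mul_right]
  congr 1
  ext j
  simp only [trTerm, cTerm, e1, Equiv.coe_addLeft]
  have h1 : (-1 : ℂ) ^ (2 * l + k + 1 + (2 * k + l + 1) + (k + l + j)) = (-1 : ℂ) ^ j := by
    rw [show 2 * l + k + 1 + (2 * k + l + 1) + (k + l + j) = j + 2 * (2 * k + 2 * l + 1) by ring,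
        zpow_add₀ (by norm_num), zpow_mul]
    norm_num
  rw [h1]
  simp only [mul_assoc, ← Complex.exp_add]
  congr 2
  push_cast
  ring

theorem G_e2 (x y τ : ℂ) (hτ : 0 < τ.im) (c : ℤ × ℤ) :
    G x y τ (e2 c) = -(dedekindEta τ * cTerm (-x) (-y) τ c) := by
  obtain ⟨k, l⟩ := c
  rw [G, ← (Equiv.subLeft (-k - l - 1)).tsum_eq, dedekindEta_eq_tsum τ hτ, ← tsum_mul_right,
    ← tsum_neg]
  congr 1
  ext j
  simp only [trTerm, cTerm, e2, Equiv.subLeft_apply]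
  have h1 : (-1 : ℂ) ^ (-(2 * l + k + 1) + -(2 * k + l + 1) + (-k - l - 1 - j))
      = -(-1 : ℂ) ^ j := by
    rw [show -(2 * l + k + 1) + -(2 * k + l + 1) + (-k - l - 1 - j)
        = j + 2 * (-2 * k - 2 * l - j - 2) + 1 by ring,
        zpow_add₀ (by norm_num), zpow_add₀ (by norm_num), zpow_mul]
    norm_num
  rw [h1]
  simp only [neg_mul, mul_assoc, ← Complex.exp_add]
  congr 3
  push_cast
  ring

theorem G_split (x y τ : ℂ) (hG : Summable (G x y τ)) :
    ∑' c, G x y τ c = ∑' c, G x y τ (e1 c) + ∑' c, G x y τ (e2 c) := by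
  have h1 : ∑' c, G x y τ (e1 c) = ∑' c, (Set.range e1).indicator (G x y τ) c := by
    rw [← e1_inj.tsum_eq Set.support_indicator_subset]
    simp
  have h2 : ∑' c, G x y τ (e2 c) = ∑' c, (Set.range e2).indicator (G x y τ) c := by
    rw [← e2_inj.tsum_eq Set.support_indicator_subset]
    simp
  rw [h1, h2, ← (hG.indicator _).tsum_add (hG.indicator _)]
  congr 1
  ext ⟨A, B⟩
  have hr1 : (A, B) ∈ Set.range e1 ↔ (A + B) % 3 = 2 := by
    constructor
    · rintro ⟨⟨k, l⟩, h⟩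
      simp only [e1, Prod.mk.injEq] at h
      omega
    · intro h
      refine ⟨((2 * B - A - 1) / 3, (2 * A - B - 1) / 3), ?_⟩
      simp only [e1, Prod.mk.injEq]
      omega
  have hr2 : (A, B) ∈ Set.range e2 ↔ (A + B) % 3 = 1 := by
    constructor
    · rintro ⟨⟨k, l⟩, h⟩
      simp only [e2, Prod.mk.injEq] at h
      omega
    · intro h
      refine ⟨((A - 2 * B - 1) / 3, (B - 2 * A - 1) / 3), ?_⟩
      simp only [e2, Prod.mk.injEq]
      omega
  classical
  rw [Set.indicator_apply, Set.indicator_apply]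
  simp only [hr1, hr2]
  rcases (by omega : (A + B) % 3 = 0 ∨ (A + B) % 3 = 1 ∨ (A + B) % 3 = 2) with h | h | h
  · rw [G_zero x y τ A B ((A + B) / 3) (by omega)]
    simp
  · simp [h]
  · simp [h]

theorem Cfun_eq (x y τ : ℂ) (h : Summable (cTerm x y τ)) : Cfun x y τ = ∑' c, cTerm x y τ c := by
  rw [h.tsum_prod]
  simp only [cTerm, tsum_mul_left]
  rfl

/-- `C(x,y|τ) − C(−x,−y|τ) = (−i/η(τ)) θ₁(x|τ) θ₁(y|τ) θ₁(x+y|τ)`. -/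
theorem C_difference (τ : ℂ) (hτ : 0 < τ.im) (x y : ℂ) :
    Cfun x y τ - Cfun (-x) (-y) τ
      = -Complex.I / dedekindEta τ * (theta1 x τ * theta1 y τ * theta1 (x + y) τ) := by
  have hη := dedekindEta_ne_zero τ hτ
  obtain ⟨hG, hT⟩ := triple x y τ hτ
  have hs1 : Summable (cTerm x y τ) := by
    have := hG.comp_injective e1_inj
    simp only [Function.comp_def, G_e1 x y τ hτ] at this
    exact (summable_mul_left_iff hη).mp this
  have hs2 : Summable (cTerm (-x) (-y) τ) := by
    have := (hG.comp_injective e2_inj).neg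
    simp only [Function.comp_def, G_e2 x y τ hτ, neg_neg] at this
    exact (summable_mul_left_iff hη).mp this
  rw [G_split x y τ hG] at hT
  simp only [G_e1 x y τ hτ, G_e2 x y τ hτ, tsum_neg, tsum_mul_left] at hT
  rw [← Cfun_eq x y τ hs1, ← Cfun_eq (-x) (-y) τ hs2] at hT
  have hth : ∀ z, theta1 z τ = -I * ∑' n, thTerm z τ n := fun z => rfl
  rw [hth, hth, hth, div_mul_eq_mul_div, eq_div_iff hη]
  have hI : I ^ 4 = 1 := Complex.I_pow_four
  linear_combination (-1 : ℂ) * hT + (- ((∑' n, thTerm x τ n) * (∑' n, thTerm y τ n) * (∑' n, thTerm (x + y) τ n))) * hI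
end

section
/- Let τ ∈ ℂ with Im τ > 0 and z ∈ ℂ. Then θ₁(z|τ)·θ₁(π/3+z|τ)·θ₁(π/3−z|τ) = (η(τ)³/η(3τ))·θ₁(3z|3τ). -/
open Complex

/-- Gaussian binomial coefficients. -/
noncomputable def gaussB (p : ℂ) : ℕ → ℕ → ℂ
  | _, 0 => 1
  | 0, _ + 1 => 0
  | M + 1, j + 1 => p ^ (j + 1) * gaussB p M (j + 1) + gaussB p M j

/-- Finite Euler products. -/
noncomputable def eulerQ (p : ℂ) (N : ℕ) : ℂ := ∏ k ∈ Finset.range N, (1 - p ^ (k + 1))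

lemma gaussB_zero (p : ℂ) (M : ℕ) : gaussB p M 0 = 1 := by
  cases M <;> simp [gaussB]

lemma gaussB_of_lt (p : ℂ) (M : ℕ) : ∀ j, M < j → gaussB p M j = 0 := by
  induction M with
  | zero => intro j hj; obtain ⟨j, rfl⟩ := Nat.exists_eq_succ_of_ne_zero hj.ne'; simp [gaussB]
  | succ M ih =>
    intro j hj
    obtain ⟨j, rfl⟩ := Nat.exists_eq_succ_of_ne_zero (by omega : j ≠ 0)
    simp [gaussB, ih (j + 1) (by omega), ih j (by omega)]

lemma eulerQ_succ (p : ℂ) (N : ℕ) : eulerQ p (N + 1) = eulerQ p N * (1 - p ^ (N + 1)) := by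
  simp [eulerQ, Finset.prod_range_succ]

lemma gaussB_self (p : ℂ) (a : ℕ) : gaussB p a a = 1 := by
  induction a with
  | zero => simp [gaussB]
  | succ a ih => simp [gaussB, ih, gaussB_of_lt p a (a + 1) (by omega)]

lemma gaussB_mul (p : ℂ) (s : ℕ) : ∀ a b, a + b = s →
    gaussB p s a * (eulerQ p a * eulerQ p b) = eulerQ p s := by
  induction s with
  | zero =>
    intro a b h
    obtain ⟨rfl, rfl⟩ : a = 0 ∧ b = 0 := by omega
    simp [gaussB, eulerQ]
  | succ s ih =>
    intro a b h
    rcases a with _ | a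
    · simp at h
      simp [gaussB, eulerQ, h]
    rcases b with _ | b
    · simp at h
      subst h
      simp [gaussB_self, eulerQ]
    have h1 := ih (a + 1) b (by omega)
    have h2 := ih a (b + 1) (by omega)
    rw [gaussB, eulerQ_succ p s]
    have hs : s = a + b + 1 := by omega
    rw [eulerQ_succ p a] at h1 ⊢
    rw [eulerQ_succ p b] at h2 ⊢
    have e : (1 - p ^ (s + 1) : ℂ) = p ^ (a + 1) * (1 - p ^ (b + 1)) + (1 - p ^ (a + 1)) := by
      rw [hs]; ring
    rw [e]
    linear_combination p ^ (a + 1) * (1 - p ^ (b + 1)) * h1 + (1 - p ^ (a + 1)) * h2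

lemma q_binomial (a : ℂ) (M : ℕ) : ∀ x : ℂ,
    ∏ k ∈ Finset.range M, (1 + cexp (x + a * k)) =
    ∑ j ∈ Finset.range (M + 1), cexp (a * (j * (j - 1) / 2) + x * j) * gaussB (cexp a) M j := by
  induction M with
  | zero => intro x; simp [gaussB]
  | succ M ih =>
    intro x
    rw [Finset.prod_range_succ']
    have h1 : ∏ k ∈ Finset.range M, (1 + cexp (x + a * ((k + 1 : ℕ) : ℂ))) =
        ∏ k ∈ Finset.range M, (1 + cexp (x + a + a * k)) := by
      refine Finset.prod_congr rfl fun k _ => ?_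
      congr 2; push_cast; ring
    rw [h1, ih, Finset.sum_range_succ' _ (M + 1)]
    have h2 : ∀ j ∈ Finset.range (M + 1),
        cexp (a * (((j + 1 : ℕ) : ℂ) * (((j + 1 : ℕ) : ℂ) - 1) / 2) + x * ((j + 1 : ℕ) : ℂ))
          * gaussB (cexp a) (M + 1) (j + 1) =
        cexp (a * (((j + 1 : ℕ) : ℂ) * (((j + 1 : ℕ) : ℂ) - 1) / 2) + (x + a) * ((j + 1 : ℕ) : ℂ))
          * gaussB (cexp a) M (j + 1) +
        cexp x * (cexp (a * ((j : ℂ) * (j - 1) / 2) + (x + a) * j) * gaussB (cexp a) M j) := by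
      intro j _
      rw [gaussB, ← Complex.exp_nat_mul, mul_add, ← mul_assoc, ← mul_assoc, ← Complex.exp_add,
        ← Complex.exp_add]
      congr 3 <;> push_cast <;> ring
    rw [Finset.sum_congr rfl h2, Finset.sum_add_distrib, ← Finset.mul_sum]
    have h3 := Finset.sum_range_succ' (fun j : ℕ =>
      cexp (a * ((j : ℂ) * (j - 1) / 2) + (x + a) * j) * gaussB (cexp a) M j) (M + 1)
    rw [Finset.sum_range_succ, gaussB_of_lt _ M (M + 1) (by omega)] at h3
    simp only [gaussB_zero] at h3 ⊢
    simp only [Nat.cast_zero, mul_zero, zero_mul, zero_div, add_zero, Complex.exp_zero] at h3 ⊢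
    linear_combination h3

/-- Truncated products. -/
noncomputable def jtpP (a b : ℂ) (N : ℕ) : ℂ :=
  ∏ k ∈ Finset.range N, ((1 + cexp (b + a * (k + 1))) * (1 + cexp (-b + a * k)))

lemma finite_jtp (a b : ℂ) (N : ℕ) :
    jtpP a b N = ∑ j ∈ Finset.range (2 * N + 1),
      cexp (a * (((j : ℂ) - N) * ((j : ℂ) - N + 1) / 2) + b * ((j : ℂ) - N))
        * gaussB (cexp a) (2 * N) j := by
  have h := q_binomial a (2 * N) (b + a - N * a)
  have e1 : ∀ N : ℕ, ∏ k ∈ Finset.range N, cexp (b - a * k) =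
      cexp (N * b - a * (N * (N - 1) / 2)) := by
    intro N
    induction N with
    | zero => simp
    | succ N ih =>
      rw [Finset.prod_range_succ, ih, ← Complex.exp_add]
      congr 1; push_cast; ring
  have e2 : ∏ k ∈ Finset.range (2 * N), (1 + cexp (b + a - N * a + a * k)) =
      cexp (N * b - a * (N * (N - 1) / 2)) * jtpP a b N := by
    rw [two_mul, Finset.prod_range_add,
      ← Finset.prod_range_reflect (fun k : ℕ => 1 + cexp (b + a - N * a + a * k)) N, jtpP,
      Finset.prod_mul_distrib, ← e1 N, mul_comm (∏ k ∈ Finset.range N, (1 + cexp (b + a * (k + 1)))),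
      ← mul_assoc]
    refine congrArg₂ (fun x y : ℂ => x * y) ?_ ?_
    · rw [← Finset.prod_mul_distrib]
      refine Finset.prod_congr rfl fun k hk => ?_
      have hk := Finset.mem_range.1 hk
      have : ((N - 1 - k : ℕ) : ℂ) = N - 1 - k := by
        rw [Nat.sub_sub, Nat.cast_sub (by omega)]; push_cast; ring
      rw [this, mul_add, ← Complex.exp_add]
      have z : b - a * k + (-b + a * k) = 0 := by ring
      rw [z, Complex.exp_zero, mul_one, add_comm]
      congr 2; ring
    · refine Finset.prod_congr rfl fun k hk => ?_
      congr 2; push_cast; ring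
  rw [e2] at h
  have hne := Complex.exp_ne_zero (N * b - a * (N * (N - 1) / 2))
  apply mul_left_cancel₀ hne
  rw [h, Finset.mul_sum]
  refine Finset.sum_congr rfl fun j _ => ?_
  rw [← mul_assoc, ← Complex.exp_add]
  congr 2; ring

/-- Coefficients of the truncated product, indexed by integers. -/
noncomputable def coefH (p : ℂ) (N : ℕ) (n : ℤ) : ℂ :=
  if 0 ≤ (N : ℤ) + n then gaussB p (2 * N) ((N : ℤ) + n).toNat else 0

lemma finite_jtp_tsum (a b : ℂ) (N : ℕ) :
    jtpP a b N = ∑' n : ℤ, cexp (a * ((n : ℂ) * (n + 1) / 2) + b * n) * coefH (cexp a) N n := by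
  rw [finite_jtp]
  have inj : Function.Injective (fun j : ℕ => (j : ℤ) - N) := fun i j h => by
    simp at h; exact h
  rw [← inj.tsum_eq]
  · rw [tsum_eq_sum (s := Finset.range (2 * N + 1))]
    · refine Finset.sum_congr rfl fun j _ => ?_
      simp [coefH]
    · intro j hj
      simp only [Finset.mem_range, not_lt] at hj
      simp [coefH, gaussB_of_lt _ (2 * N) j (by omega)]
  · intro n hn
    by_cases h : 0 ≤ (N : ℤ) + n
    · exact ⟨((N : ℤ) + n).toNat, by simp [h]⟩
    · simp [coefH, h] at hn

lemma norm_p_lt {τ : ℂ} (hτ : 0 < τ.im) : ‖cexp (2 * Real.pi * I * τ)‖ < 1 :=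
  UpperHalfPlane.norm_exp_two_pi_I_lt_one ⟨τ, hτ⟩

/-- The infinite Euler product. -/
noncomputable def eulerInf (p : ℂ) : ℂ := ∏' k : ℕ, (1 - p ^ (k + 1))

lemma eulerQ_tendsto {p : ℂ} (hp : ‖p‖ < 1) :
    Filter.Tendsto (eulerQ p) Filter.atTop (nhds (eulerInf p)) :=
  (ModularForm.multipliable_one_sub_pow hp).hasProd.tendsto_prod_nat

lemma factor_ne {p : ℂ} (hp : ‖p‖ < 1) (k : ℕ) : 1 - p ^ (k + 1) ≠ 0 := by
  intro h
  have h1 : ‖p ^ (k + 1)‖ = 1 := by rw [← sub_eq_zero.1 h]; simp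
  rw [norm_pow] at h1
  exact absurd h1 (pow_lt_one₀ (norm_nonneg _) hp (by omega)).ne

lemma eulerInf_ne {p : ℂ} (hp : ‖p‖ < 1) : eulerInf p ≠ 0 := by
  have := tprod_one_add_ne_zero_of_summable (f := fun n : ℕ => -p ^ (n + 1))
    (fun k => by simpa [sub_eq_add_neg] using factor_ne hp k)
    (by simpa using (summable_nat_add_iff 1).mpr (summable_geometric_of_lt_one (norm_nonneg _) hp))
  simpa [eulerInf, sub_eq_add_neg] using this

lemma eulerQ_ne {p : ℂ} (hp : ‖p‖ < 1) (N : ℕ) : eulerQ p N ≠ 0 :=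
  Finset.prod_ne_zero_iff.2 fun k _ => factor_ne hp k

lemma gaussB_eq {p : ℂ} (hp : ‖p‖ < 1) {s a b : ℕ} (h : a + b = s) :
    gaussB p s a = eulerQ p s * ((eulerQ p a)⁻¹ * (eulerQ p b)⁻¹) := by
  have h1 := eulerQ_ne hp a
  have h2 := eulerQ_ne hp b
  rw [← gaussB_mul p s a b h]
  field_simp

lemma gaussB_bdd {p : ℂ} (hp : ‖p‖ < 1) : ∃ C : ℝ, 0 ≤ C ∧ ∀ M j, ‖gaussB p M j‖ ≤ C := by
  obtain ⟨A, hA⟩ := (Metric.isBounded_range_of_tendsto _ (eulerQ_tendsto hp)).exists_norm_le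
  obtain ⟨B, hB⟩ := (Metric.isBounded_range_of_tendsto _
    ((eulerQ_tendsto hp).inv₀ (eulerInf_ne hp))).exists_norm_le
  have hA' : ∀ n, ‖eulerQ p n‖ ≤ A := fun n => hA _ ⟨n, rfl⟩
  have hB' : ∀ n, ‖(eulerQ p n)⁻¹‖ ≤ B := fun n => hB _ ⟨n, rfl⟩
  have hA0 : 0 ≤ A := (norm_nonneg _).trans (hA' 0)
  have hB0 : 0 ≤ B := (norm_nonneg _).trans (hB' 0)
  refine ⟨A * (B * B), by positivity, fun M j => ?_⟩
  by_cases h : j ≤ M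
  · rw [gaussB_eq hp (Nat.add_sub_cancel' h), norm_mul, norm_mul]
    gcongr
    · exact hA' _
    · exact hB' _
    · exact hB' _
  · rw [gaussB_of_lt p M j (by omega), norm_zero]
    positivity

lemma coefH_tendsto {p : ℂ} (hp : ‖p‖ < 1) (n : ℤ) :
    Filter.Tendsto (fun N => coefH p N n) Filter.atTop (nhds (eulerInf p)⁻¹) := by
  have hQ := eulerQ_tendsto hp
  have hI := hQ.inv₀ (eulerInf_ne hp)
  have t1 : Filter.Tendsto (fun N : ℕ => 2 * N) Filter.atTop Filter.atTop :=
    Filter.tendsto_atTop_mono (fun N => by simp only [id]; omega) Filter.tendsto_id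
  have t2 : ∀ n : ℤ, Filter.Tendsto (fun N : ℕ => ((N : ℤ) + n).toNat)
      Filter.atTop Filter.atTop := fun n =>
    Filter.tendsto_atTop.2 fun b => by
      filter_upwards [Filter.eventually_ge_atTop (b + n.natAbs)] with N hN
      omega
  have := (hQ.comp t1).mul ((hI.comp (t2 n)).mul (hI.comp (t2 (-n))))
  rw [show eulerInf p * ((eulerInf p)⁻¹ * (eulerInf p)⁻¹) = (eulerInf p)⁻¹ by
    have := eulerInf_ne hp; field_simp] at this
  refine this.congr' ?_
  filter_upwards [Filter.eventually_ge_atTop n.natAbs] with N hN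
  rw [coefH, if_pos (by omega), gaussB_eq hp (b := ((N : ℤ) + -n).toNat) (by omega)]
  rfl

/-- The theta series. -/
noncomputable def thS (a b : ℂ) : ℂ := ∑' n : ℤ, cexp (a * ((n : ℂ) * (n + 1) / 2) + b * n)

lemma jtp {τ : ℂ} (hτ : 0 < τ.im) (b : ℂ) :
    Filter.Tendsto (jtpP (2 * Real.pi * I * τ) b) Filter.atTop
      (nhds (thS (2 * Real.pi * I * τ) b * (eulerInf (cexp (2 * Real.pi * I * τ)))⁻¹)) := by
  have hp := norm_p_lt hτ
  set a := 2 * Real.pi * I * τ with ha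
  obtain ⟨C, hC0, hC⟩ := gaussB_bdd hp
  have hs : Summable fun n : ℤ => cexp (a * ((n : ℂ) * (n + 1) / 2) + b * n) := by
    refine ((summable_jacobiTheta₂_term_iff (τ / 2 + b / (2 * Real.pi * I)) τ).2 hτ).congr
      fun n => ?_
    rw [jacobiTheta₂_term, ha]
    congr 1
    have : (Real.pi : ℂ) ≠ 0 := by exact_mod_cast Real.pi_ne_zero
    have := I_ne_zero
    field_simp
    ring
  rw [thS, ← tsum_mul_right]
  rw [show jtpP a b = _ from funext (finite_jtp_tsum a b)]
  refine tendsto_tsum_of_dominated_convergence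
    (bound := fun n : ℤ => ‖cexp (a * ((n : ℂ) * (n + 1) / 2) + b * n)‖ * C)
    (hs.norm.mul_right C) (fun n => (coefH_tendsto hp n).const_mul _) ?_
  refine Filter.Eventually.of_forall fun N n => ?_
  rw [norm_mul]
  gcongr
  rw [coefH]
  split_ifs
  · exact hC _ _
  · simpa using hC0

lemma theta1_eq (z τ : ℂ) : theta1 z τ = -I * cexp (I * z + Real.pi * I * τ / 4) *
    thS (2 * Real.pi * I * τ) (2 * I * z + Real.pi * I) := by
  rw [theta1, thS, mul_assoc (-I) (cexp (I * z + Real.pi * I * τ / 4)),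
    ← tsum_mul_left (a := cexp (I * z + Real.pi * I * τ / 4))]
  refine congrArg (fun x => -I * x) (tsum_congr fun n => ?_)
  have h : (-1 : ℂ) ^ n = cexp (n * (Real.pi * I)) := by
    rw [Complex.exp_int_mul, Complex.exp_pi_mul_I]
  rw [h, ← Complex.exp_add, ← Complex.exp_add, ← Complex.exp_add]
  congr 1
  ring

lemma theta1_neg (z τ : ℂ) : theta1 (-z) τ = -theta1 z τ := by
  rw [theta1, theta1, ← mul_neg, ← tsum_neg, ← (Equiv.subLeft (-1 : ℤ)).tsum_eq]
  congr 2
  ext n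
  have h : (-1 : ℂ) ^ (-1 - n) = -(-1 : ℂ) ^ n := by
    rw [zpow_sub₀ (by norm_num), zpow_neg_one]
    rcases Int.even_or_odd n with h | h
    · rw [h.neg_one_zpow]; norm_num
    · rw [h.neg_one_zpow]; norm_num
  simp only [Equiv.subLeft_apply]
  rw [h, neg_mul, neg_mul]
  congr 2
  · congr 2; push_cast; ring
  · congr 1; push_cast; ring

lemma eta_eq (τ : ℂ) : dedekindEta τ =
    cexp (Real.pi * I * τ / 12) * eulerInf (cexp (2 * Real.pi * I * τ)) := by
  rw [dedekindEta, eulerInf]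
  congr 2
  ext k
  rw [← Complex.exp_nat_mul]
  congr 2; push_cast; ring

lemma omega_rel : 1 + cexp (2 * Real.pi * I / 3) + cexp (-(2 * Real.pi * I / 3)) = 0 := by
  set w := cexp (2 * Real.pi * I / 3) with hw
  have h3 : IsPrimitiveRoot w 3 := Complex.isPrimitiveRoot_exp 3 (by norm_num)
  have hs := h3.geom_sum_eq_zero (by norm_num)
  simp [Finset.sum_range_succ] at hs
  have hi : cexp (-(2 * Real.pi * I / 3)) = w ^ 2 := by
    rw [Complex.exp_neg, ← hw]
    have := h3.pow_eq_one
    exact inv_eq_of_mul_eq_one_right (by linear_combination this)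
  rw [hi]; exact hs

lemma triple_factor (u : ℂ) :
    (1 + cexp u) * (1 + cexp (u + 2 * Real.pi * I / 3)) * (1 + cexp (u - 2 * Real.pi * I / 3))
      = 1 + cexp (3 * u) := by
  have h := omega_rel
  have hm : cexp (2 * Real.pi * I / 3) * cexp (-(2 * Real.pi * I / 3)) = 1 := by
    rw [← Complex.exp_add]; simp
  rw [sub_eq_add_neg, Complex.exp_add, Complex.exp_add,
    show 3 * u = u + u + u by ring, Complex.exp_add, Complex.exp_add]
  generalize cexp u = x at *
  generalize cexp (2 * Real.pi * I / 3) = w at *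
  generalize cexp (-(2 * Real.pi * I / 3)) = v at *
  linear_combination (x + x ^ 2) * h + (x ^ 2 + x ^ 3) * hm

lemma jtpP_triple (a b : ℂ) (N : ℕ) :
    jtpP a b N * jtpP a (b + 2 * Real.pi * I / 3) N * jtpP a (b - 2 * Real.pi * I / 3) N
      = jtpP (3 * a) (3 * b) N := by
  simp only [jtpP, ← Finset.prod_mul_distrib]
  refine Finset.prod_congr rfl fun k _ => ?_
  have h1 := triple_factor (b + a * (k + 1))
  have h2 := triple_factor (-b + a * k)
  rw [show 3 * b + 3 * a * ((k : ℂ) + 1) = 3 * (b + a * (k + 1)) by ring,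
    show -(3 * b) + 3 * a * (k : ℂ) = 3 * (-b + a * k) by ring, ← h1, ← h2,
    show b + 2 * Real.pi * I / 3 + a * ((k : ℂ) + 1) = b + a * (k + 1) + 2 * Real.pi * I / 3 by ring,
    show b - 2 * Real.pi * I / 3 + a * ((k : ℂ) + 1) = b + a * (k + 1) - 2 * Real.pi * I / 3 by ring,
    show -(b + 2 * Real.pi * I / 3) + a * (k : ℂ) = -b + a * k - 2 * Real.pi * I / 3 by ring,
    show -(b - 2 * Real.pi * I / 3) + a * (k : ℂ) = -b + a * k + 2 * Real.pi * I / 3 by ring]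
  ring

lemma jtpP_period (a b : ℂ) : jtpP a (b + 2 * Real.pi * I) = jtpP a b := by
  funext N
  refine Finset.prod_congr rfl fun k _ => ?_
  rw [show b + 2 * Real.pi * I + a * ((k : ℂ) + 1) = b + a * (k + 1) + 2 * Real.pi * I by ring,
    show -(b + 2 * Real.pi * I) + a * (k : ℂ) = -b + a * k - 2 * Real.pi * I by ring,
    Complex.exp_periodic, Complex.exp_periodic.sub_eq]

/-- `θ₁(z|τ) θ₁(π/3+z|τ) θ₁(π/3−z|τ) = (η(τ)³/η(3τ)) θ₁(3z|3τ)`. -/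
theorem theta1_triplication (τ : ℂ) (hτ : 0 < τ.im) (z : ℂ) :
    theta1 z τ * theta1 ((Real.pi : ℂ) / 3 + z) τ * theta1 ((Real.pi : ℂ) / 3 - z) τ
      = dedekindEta τ ^ 3 / dedekindEta (3 * τ) * theta1 (3 * z) (3 * τ) := by
  have hτ3 : 0 < (3 * τ).im := by simpa using hτ
  have hE := eulerInf_ne (norm_p_lt hτ)
  have hE3 := eulerInf_ne (norm_p_lt hτ3)
  have l3 := jtp hτ3 (2 * I * (3 * z) + Real.pi * I)
  have l := ((jtp hτ (2 * I * z + Real.pi * I)).mul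
    (jtp hτ (2 * I * ((Real.pi : ℂ) / 3 + z) + Real.pi * I))).mul
    (jtp hτ (2 * I * (z - (Real.pi : ℂ) / 3) + Real.pi * I))
  have key := tendsto_nhds_unique (l.congr fun N => by
    rw [show 2 * I * ((Real.pi : ℂ) / 3 + z) + Real.pi * I
        = (2 * I * z + Real.pi * I) + 2 * Real.pi * I / 3 by ring,
      show 2 * I * (z - (Real.pi : ℂ) / 3) + Real.pi * I
        = (2 * I * z + Real.pi * I) - 2 * Real.pi * I / 3 by ring,
      jtpP_triple, show 3 * (2 * I * z + Real.pi * I)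
        = (2 * I * (3 * z) + Real.pi * I) + 2 * Real.pi * I by ring,
      jtpP_period, show 3 * (2 * Real.pi * I * τ) = 2 * Real.pi * I * (3 * τ) by ring]) l3
  rw [show (Real.pi : ℂ) / 3 - z = -(z - (Real.pi : ℂ) / 3) by ring, theta1_neg]
  simp only [theta1_eq, eta_eq]
  generalize thS (2 * Real.pi * I * τ) (2 * I * z + Real.pi * I) = A at *
  generalize thS (2 * Real.pi * I * τ) (2 * I * ((Real.pi : ℂ) / 3 + z) + Real.pi * I) = B at *
  generalize thS (2 * Real.pi * I * τ) (2 * I * (z - (Real.pi : ℂ) / 3) + Real.pi * I) = C at *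
  generalize thS (2 * Real.pi * I * (3 * τ)) (2 * I * (3 * z) + Real.pi * I) = D at *
  generalize eulerInf (cexp (2 * Real.pi * I * τ)) = E at *
  generalize eulerInf (cexp (2 * Real.pi * I * (3 * τ))) = F at *
  have hk : A * B * C = E ^ 3 / F * D := by
    field_simp at key ⊢
    linear_combination key
  have x1 : cexp (I * z + Real.pi * I * τ / 4) *
      cexp (I * ((Real.pi : ℂ) / 3 + z) + Real.pi * I * τ / 4) *
      cexp (I * (z - (Real.pi : ℂ) / 3) + Real.pi * I * τ / 4) =
      cexp (I * (3 * z) + Real.pi * I * (3 * τ) / 4) := by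
    rw [← Complex.exp_add, ← Complex.exp_add]; congr 1; ring
  have x2 : cexp (Real.pi * I * τ / 12) ^ 3 = cexp (Real.pi * I * (3 * τ) / 12) := by
    rw [← Complex.exp_nat_mul]; congr 1; push_cast; ring
  rw [mul_pow, x2, mul_div_mul_left _ _ (Complex.exp_ne_zero _), ← x1]
  have hI : I ^ 3 = -I := by rw [pow_succ, I_sq]; ring
  generalize cexp (I * z + Real.pi * I * τ / 4) = X
  generalize cexp (I * ((Real.pi : ℂ) / 3 + z) + Real.pi * I * τ / 4) = Y
  generalize cexp (I * (z - (Real.pi : ℂ) / 3) + Real.pi * I * τ / 4) = Z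
  linear_combination (X * Y * Z * A * B * C) * hI - I * X * Y * Z * hk
end

section
/- Let τ ∈ ℂ with Im τ > 0 and let x, y ∈ ℂ. Then C(x,y|τ)³ − C(−x,−y|τ)³ = −i·(η(τ)⁶/η(3τ)³)·θ₁(3x|3τ)·θ₁(3y|3τ)·θ₁(3x+3y|3τ). -/
open Complex

open Filter Topology

/-- `∏_{k<n} (1 - q^(k+1))`. -/
noncomputable def qfac (q : ℂ) (n : ℕ) : ℂ := ∏ k ∈ Finset.range n, (1 - q ^ (k + 1))

/-- reciprocal of `qfac`, extended by zero to negative integers. -/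
noncomputable def rfac (q : ℂ) (a : ℤ) : ℂ := if 0 ≤ a then (qfac q a.toNat)⁻¹ else 0

lemma one_sub_pow_ne {q : ℂ} (hq : ‖q‖ < 1) (k : ℕ) : 1 - q ^ (k + 1) ≠ 0 := by
  intro h
  have h1 : q ^ (k + 1) = 1 := (sub_eq_zero.mp h).symm
  have h2 : ‖q‖ ^ (k + 1) = 1 := by rw [← norm_pow, h1, norm_one]
  have h3 : ‖q‖ ^ (k + 1) < 1 := pow_lt_one₀ (norm_nonneg _) hq (Nat.succ_ne_zero k)
  linarith

lemma qfac_ne {q : ℂ} (hq : ‖q‖ < 1) (n : ℕ) : qfac q n ≠ 0 :=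
  Finset.prod_ne_zero_iff.mpr fun k _ => one_sub_pow_ne hq k

lemma qfac_succ (q : ℂ) (n : ℕ) : qfac q (n + 1) = qfac q n * (1 - q ^ (n + 1)) :=
  Finset.prod_range_succ _ _

lemma rfac_step {q : ℂ} (hq : ‖q‖ < 1) (a : ℤ) : (1 - q ^ a) * rfac q a = rfac q (a - 1) := by
  rcases lt_trichotomy a 0 with h | h | h
  · have h1 : ¬ (0 ≤ a) := by omega
    have h2 : ¬ (0 ≤ a - 1) := by omega
    unfold rfac
    rw [if_neg h1, if_neg h2, mul_zero]
  · subst h; simp [rfac]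
  · obtain ⟨n, rfl⟩ : ∃ n : ℕ, a = (n : ℤ) + 1 := ⟨(a - 1).toNat, by omega⟩
    have e1 : ((n : ℤ) + 1).toNat = n + 1 := by omega
    have e2 : ((n : ℤ) + 1 - 1).toNat = n := by omega
    have h1 : (0 : ℤ) ≤ (n : ℤ) + 1 := by omega
    have h2 : (0 : ℤ) ≤ (n : ℤ) + 1 - 1 := by omega
    unfold rfac
    rw [if_pos h1, if_pos h2, e1, e2, qfac_succ]
    have e3 : q ^ ((n : ℤ) + 1) = q ^ (n + 1) := by
      rw [← zpow_natCast]; push_cast; rfl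
    rw [e3]
    have := one_sub_pow_ne hq n
    have := qfac_ne hq n
    field_simp

lemma multipliable_one_sub_geom {q : ℂ} (hq : ‖q‖ < 1) (a : ℂ) :
    Multipliable fun n : ℕ => 1 - a * q ^ n := by
  have := multipliable_one_add_of_summable (f := fun n : ℕ => -(a * q ^ n)) (by
    simpa using (summable_geometric_of_lt_one (norm_nonneg _) hq).mul_left ‖a‖)
  simpa [sub_eq_add_neg] using this

/-- `(a;q)_∞`. -/
noncomputable def qinf (a q : ℂ) : ℂ := ∏' n : ℕ, (1 - a * q ^ n)

lemma qinf_tendsto {q : ℂ} (hq : ‖q‖ < 1) (a : ℂ) :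
    Tendsto (fun n => ∏ k ∈ Finset.range n, (1 - a * q ^ k)) atTop (𝓝 (qinf a q)) :=
  (multipliable_one_sub_geom hq a).hasProd.tendsto_prod_nat

lemma qfac_tendsto {q : ℂ} (hq : ‖q‖ < 1) : Tendsto (qfac q) atTop (𝓝 (qinf q q)) := by
  convert! qinf_tendsto hq q using 2 with n
  unfold qfac
  simp only [pow_succ']

lemma qinf_ne {q : ℂ} (hq : ‖q‖ < 1) : qinf q q ≠ 0 := by
  unfold qinf
  have := tprod_one_add_ne_zero_of_summable (f := fun n : ℕ => -(q * q ^ n)) (by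
    intro n
    have := one_sub_pow_ne hq n
    rw [pow_succ'] at this
    simpa [sub_eq_add_neg] using this) (by
    simpa using (summable_geometric_of_lt_one (norm_nonneg _) hq).mul_left ‖q‖)
  simpa [sub_eq_add_neg] using this

lemma rfac_tendsto {q : ℂ} (hq : ‖q‖ < 1) :
    Tendsto (fun n : ℕ => (qfac q n)⁻¹) atTop (𝓝 (qinf q q)⁻¹) :=
  (qfac_tendsto hq).inv₀ (qinf_ne hq)

lemma rfac_bdd {q : ℂ} (hq : ‖q‖ < 1) : ∃ M : ℝ, 0 ≤ M ∧ ∀ a, ‖rfac q a‖ ≤ M := by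
  obtain ⟨M, hM⟩ := (Metric.isBounded_range_of_tendsto _ (rfac_tendsto hq)).exists_norm_le
  refine ⟨M, (norm_nonneg _).trans (hM _ ⟨0, rfl⟩), fun a => ?_⟩
  unfold rfac
  split_ifs
  · exact hM _ ⟨_, rfl⟩
  · simpa using (norm_nonneg _).trans (hM _ ⟨0, rfl⟩)

lemma w_ne {q z : ℂ} (hq0 : q ≠ 0) (hz : z ≠ 0) {w : ℤ → ℂ} (h0 : w 0 = 1)
    (hw : ∀ j, w (j + 1) = -z * q ^ j * w j) (j : ℤ) : w j ≠ 0 := by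
  induction j using Int.induction_on with
  | zero => simp [h0]
  | succ i ih => rw [hw]; exact mul_ne_zero (mul_ne_zero (neg_ne_zero.mpr hz) (zpow_ne_zero _ hq0)) ih
  | pred i ih =>
    intro h
    have := hw (-(i : ℤ) - 1)
    rw [h, mul_zero, sub_add_cancel] at this
    exact ih this

lemma w_summable {q z : ℂ} (hq0 : q ≠ 0) (hq : ‖q‖ < 1) (hz : z ≠ 0) {w : ℤ → ℂ} (h0 : w 0 = 1)
    (hw : ∀ j, w (j + 1) = -z * q ^ j * w j) : Summable w := by
  have hne := w_ne hq0 hz h0 hw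
  have hg : Tendsto (fun n : ℕ => ‖q‖ ^ n) atTop (𝓝 0) :=
    tendsto_pow_atTop_nhds_zero_of_lt_one (norm_nonneg _) hq
  apply Summable.of_nat_of_neg
  · refine summable_of_ratio_test_tendsto_lt_one (l := 0) one_pos (.of_forall fun n => hne _) ?_
    have : Tendsto (fun n : ℕ => ‖z‖ * ‖q‖ ^ n) atTop (𝓝 0) := by simpa using hg.const_mul ‖z‖
    refine this.congr fun n => ?_
    have h1 : ‖w n‖ ≠ 0 := norm_ne_zero_iff.mpr (hne _)
    push_cast
    rw [hw, norm_mul, norm_mul, norm_neg, zpow_natCast, norm_pow]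
    field_simp
  · refine summable_of_ratio_test_tendsto_lt_one (l := 0) one_pos (.of_forall fun n => hne _) ?_
    have : Tendsto (fun n : ℕ => ‖z‖⁻¹ * ‖q‖ * ‖q‖ ^ n) atTop (𝓝 0) := by
      simpa using hg.const_mul (‖z‖⁻¹ * ‖q‖)
    refine this.congr fun n => ?_
    have h1 : ‖w (-((n + 1 : ℕ) : ℤ))‖ ≠ 0 := norm_ne_zero_iff.mpr (hne _)
    have h2 := hw (-((n + 1 : ℕ) : ℤ))
    have e : -((n + 1 : ℕ) : ℤ) + 1 = -(n : ℤ) := by push_cast; ring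
    rw [e] at h2
    rw [h2, norm_mul, norm_mul, norm_neg, norm_zpow, zpow_neg, zpow_natCast]
    have : ‖z‖ ≠ 0 := norm_ne_zero_iff.mpr hz
    have : ‖q‖ ≠ 0 := norm_ne_zero_iff.mpr hq0
    field_simp
    ring

lemma jtp_finite {q z : ℂ} (hq0 : q ≠ 0) (hq : ‖q‖ < 1) (hz : z ≠ 0) {w : ℤ → ℂ} (h0 : w 0 = 1)
    (hw : ∀ j, w (j + 1) = -z * q ^ j * w j) (n : ℕ) :
    ∏ k ∈ Finset.range n, ((1 - z * q ^ k) * (1 - q / z * q ^ k)) =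
      qfac q (2 * n) * ∑' j : ℤ, w j * (rfac q (n - j) * rfac q (n + j)) := by
  obtain ⟨M, hM0, hM⟩ := rfac_bdd hq
  have hws := w_summable hq0 hq hz h0 hw
  have hsum : ∀ n : ℕ, Summable fun j : ℤ => w j * (rfac q (n - j) * rfac q (n + j)) := by
    intro n
    refine Summable.of_norm_bounded (hws.norm.mul_right (M * M)) fun j => ?_
    rw [norm_mul, norm_mul]
    gcongr
    · exact hM _
    · exact hM _
  induction n with
  | zero =>
    rw [tsum_eq_single 0]
    · simp [h0, rfac, qfac]
    · intro j hj
      rcases lt_or_gt_of_ne hj with h | h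
      · have : ¬ (0 ≤ ((0 : ℕ) : ℤ) + j) := by simp; omega
        simp only [rfac, if_neg this, mul_zero]
      · have : ¬ (0 ≤ ((0 : ℕ) : ℤ) - j) := by simp; omega
        simp only [rfac, if_neg this, mul_zero, zero_mul]
  | succ n ih =>
    rw [Finset.prod_range_succ, ih]
    obtain ⟨f, hf⟩ : ∃ f : ℤ → ℂ, f = fun j : ℤ => w j * (rfac q (n - j) * rfac q (n + j)) :=
      ⟨_, rfl⟩
    have hs : Summable f := hf ▸ hsum n
    rw [← hf]
    have hs1 : Summable fun j => f (j - 1) := (Equiv.subRight (1 : ℤ)).summable_iff (f := f) |>.mpr hs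
    have hs2 : Summable fun j => f (j + 1) := (Equiv.addRight (1 : ℤ)).summable_iff (f := f) |>.mpr hs
    have t1 : ∑' j, f (j - 1) = ∑' j, f j := (Equiv.subRight (1 : ℤ)).tsum_eq f
    have t2 : ∑' j, f (j + 1) = ∑' j, f j := (Equiv.addRight (1 : ℤ)).tsum_eq f
    have key : (∑' j, f j) * ((1 - z * q ^ n) * (1 - q / z * q ^ n)) =
        ∑' j, ((1 + q ^ (2 * n + 1)) * f j - z * q ^ n * f (j - 1) - q / z * q ^ n * f (j + 1)) := by
      rw [Summable.tsum_sub ((hs.mul_left _).sub (hs1.mul_left _)) (hs2.mul_left _),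
        Summable.tsum_sub (hs.mul_left _) (hs1.mul_left _), tsum_mul_left, tsum_mul_left,
        tsum_mul_left, t1, t2]
      field_simp
      ring
    rw [mul_assoc, key, show 2 * (n + 1) = 2 * n + 1 + 1 by ring, qfac_succ, qfac_succ, mul_assoc,
      mul_assoc]
    congr 1
    rw [← tsum_mul_left, ← tsum_mul_left]
    apply tsum_congr
    intro j
    simp only [hf]
    push_cast
    have w1 : w j = -z * q ^ (j - 1) * w (j - 1) := by rw [← hw, sub_add_cancel]
    have w2 := hw j
    have w1' : w (j - 1) = - w j * (z * q ^ (j - 1))⁻¹ := by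
      rw [w1]; have := zpow_ne_zero (j - 1) hq0; field_simp
    rw [w1', w2]
    have a1 : rfac q ((n : ℤ) - j) = (1 - q ^ ((n : ℤ) + 1 - j)) * rfac q ((n : ℤ) + 1 - j) := by
      rw [rfac_step hq]; congr 1; ring
    have a2 : rfac q ((n : ℤ) - (j + 1)) = (1 - q ^ ((n : ℤ) - j)) * rfac q ((n : ℤ) - j) := by
      rw [rfac_step hq]; congr 1; ring
    have a3 : rfac q ((n : ℤ) + j) = (1 - q ^ ((n : ℤ) + 1 + j)) * rfac q ((n : ℤ) + 1 + j) := by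
      rw [rfac_step hq]; congr 1; ring
    have a4 : rfac q ((n : ℤ) + (j - 1)) = (1 - q ^ ((n : ℤ) + j)) * rfac q ((n : ℤ) + j) := by
      rw [rfac_step hq]; congr 1; ring
    have a5 : (n : ℤ) - (j - 1) = n + 1 - j := by ring
    have a6 : (n : ℤ) + (j + 1) = n + 1 + j := by ring
    rw [a2, a1, a4, a3, a5, a6]
    generalize rfac q ((n : ℤ) + 1 - j) = A
    generalize rfac q ((n : ℤ) + 1 + j) = B
    generalize w j = W
    have b1 : q ^ ((n : ℤ) + 1 - j) = q ^ n * q / q ^ j := by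
      rw [zpow_sub₀ hq0, zpow_add₀ hq0]; simp
    have b2 : q ^ ((n : ℤ) - j) = q ^ n / q ^ j := by
      rw [zpow_sub₀ hq0]; simp
    have b3 : q ^ ((n : ℤ) + 1 + j) = q ^ n * q * q ^ j := by
      rw [zpow_add₀ hq0, zpow_add₀ hq0]; simp
    have b4 : q ^ ((n : ℤ) + j) = q ^ n * q ^ j := by
      rw [zpow_add₀ hq0]; simp
    have b5 : q ^ (j - 1) = q ^ j / q := by
      rw [zpow_sub₀ hq0]; simp
    have b6 : q ^ (2 * n + 1) = q ^ n * q ^ n * q := by ring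
    have b7 : q ^ (2 * n + 1 + 1) = q ^ n * q ^ n * q * q := by ring
    rw [b1, b2, b3, b4, b5, b6, b7]
    have hj : q ^ j ≠ 0 := zpow_ne_zero j hq0
    generalize q ^ j = J at *
    generalize q ^ n = N at *
    field_simp
    ring

/-- The Jacobi triple product. -/
lemma jtp_s9 {q z : ℂ} (hq0 : q ≠ 0) (hq : ‖q‖ < 1) (hz : z ≠ 0) {w : ℤ → ℂ} (h0 : w 0 = 1)
    (hw : ∀ j, w (j + 1) = -z * q ^ j * w j) :
    ∑' j, w j = qinf q q * qinf z q * qinf (q / z) q := by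
  obtain ⟨M, hM0, hM⟩ := rfac_bdd hq
  have hws := w_summable hq0 hq hz h0 hw
  have hne := qinf_ne hq
  have L1 : Tendsto (fun n : ℕ => ∑' j : ℤ, w j * (rfac q (n - j) * rfac q (n + j))) atTop
      (𝓝 (∑' j : ℤ, w j * ((qinf q q)⁻¹ * (qinf q q)⁻¹))) := by
    refine tendsto_tsum_of_dominated_convergence (bound := fun j => ‖w j‖ * (M * M))
      (hws.norm.mul_right (M * M)) (fun j => ?_) (.of_forall fun n j => ?_)
    · have g : Tendsto (fun a : ℤ => rfac q a) atTop (𝓝 (qinf q q)⁻¹) := by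
        have h1 : Tendsto (fun a : ℤ => a.toNat) atTop atTop :=
          tendsto_atTop.mpr fun b => by
            filter_upwards [eventually_ge_atTop (b : ℤ)] with a ha
            omega
        refine ((rfac_tendsto hq).comp h1).congr' ?_
        filter_upwards [eventually_ge_atTop (0 : ℤ)] with a ha
        simp [rfac, ha]
      refine Tendsto.const_mul _ (Tendsto.mul (g.comp ?_) (g.comp ?_))
      · exact tendsto_atTop_add_const_right _ (-j) tendsto_natCast_atTop_atTop
      · exact tendsto_atTop_add_const_right _ j tendsto_natCast_atTop_atTop
    · rw [norm_mul, norm_mul]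
      gcongr
      · exact hM _
      · exact hM _
  have L2 : Tendsto (fun n : ℕ => qfac q (2 * n)) atTop (𝓝 (qinf q q)) :=
    (qfac_tendsto hq).comp (tendsto_id.const_mul_atTop' two_pos)
  have L3 := (qinf_tendsto hq z).mul (qinf_tendsto hq (q / z))
  have L4 := L2.mul L1
  have := tendsto_nhds_unique (L3.congr fun n => by
    rw [← Finset.prod_mul_distrib, jtp_finite hq0 hq hz h0 hw]) L4
  rw [tsum_mul_right] at this
  rw [mul_assoc, this]
  field_simp

/-- The nome `q = exp(2πiτ)`. -/
noncomputable def nome (τ : ℂ) : ℂ := Complex.exp (2 * Real.pi * Complex.I * τ)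

lemma nome_ne (τ : ℂ) : nome τ ≠ 0 := Complex.exp_ne_zero _

lemma nome_lt {τ : ℂ} (hτ : 0 < τ.im) : ‖nome τ‖ < 1 := by
  unfold nome
  rw [Complex.norm_exp, Real.exp_lt_one_iff]
  have : (2 * (Real.pi : ℂ) * Complex.I * τ).re = -(2 * Real.pi * τ.im) := by
    simp
  rw [this]
  have := Real.pi_pos
  have : 0 < 2 * Real.pi * τ.im := by positivity
  linarith

lemma nome_zpow (τ : ℂ) (j : ℤ) :
    nome τ ^ j = Complex.exp (2 * Real.pi * Complex.I * τ * j) := by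
  unfold nome
  rw [← Complex.exp_int_mul]; congr 1; ring

lemma nome_three (τ : ℂ) : nome (3 * τ) = nome τ ^ 3 := by
  unfold nome
  rw [← Complex.exp_nat_mul]; congr 1; push_cast; ring

/-- theta summand normalised to be `1` at `0`. -/
noncomputable def wth (z τ : ℂ) (n : ℤ) : ℂ :=
  (-1 : ℂ) ^ n * Complex.exp (Real.pi * Complex.I * τ * (n * (n + 1))) *
    Complex.exp (2 * n * Complex.I * z)

lemma wth_zero (z τ : ℂ) : wth z τ 0 = 1 := by simp [wth]

lemma wth_step (z τ : ℂ) (j : ℤ) :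
    wth z τ (j + 1) = -(nome τ * Complex.exp (2 * Complex.I * z)) * nome τ ^ j * wth z τ j := by
  rw [nome_zpow]
  unfold wth nome
  rw [zpow_add_one₀ (by norm_num)]
  have : ∀ a b c d e s : ℂ, -(Complex.exp a * Complex.exp b) * Complex.exp c * (s * Complex.exp d *
      Complex.exp e) = s * (-1) * Complex.exp (a + b + c + d + e) := by
    intros; simp only [Complex.exp_add]; ring
  rw [this, mul_assoc, ← Complex.exp_add]
  congr 2
  push_cast
  ring

lemma wth_summable {τ : ℂ} (hτ : 0 < τ.im) (z : ℂ) : Summable (wth z τ) :=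
  w_summable (nome_ne τ) (nome_lt hτ) (mul_ne_zero (nome_ne τ) (Complex.exp_ne_zero _))
    (wth_zero z τ) (wth_step z τ)

lemma theta1_term (z τ : ℂ) (n : ℤ) :
    (-1 : ℂ) ^ n * Complex.exp (Real.pi * Complex.I * τ * (2 * (n : ℂ) + 1) ^ 2 / 4) *
      Complex.exp ((2 * (n : ℂ) + 1) * Complex.I * z) =
    (Complex.exp (Real.pi * Complex.I * τ / 4) * Complex.exp (Complex.I * z)) * wth z τ n := by
  unfold wth
  have : ∀ a b d e s : ℂ, (Complex.exp a * Complex.exp b) * (s * Complex.exp d *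
      Complex.exp e) = s * Complex.exp (a + b + d + e) := by
    intros; simp only [Complex.exp_add]; ring
  rw [this, mul_assoc, ← Complex.exp_add]
  congr 2
  ring

lemma theta1_prod {τ : ℂ} (hτ : 0 < τ.im) (z : ℂ) :
    theta1 z τ = -Complex.I * (Complex.exp (Real.pi * Complex.I * τ / 4) *
      Complex.exp (Complex.I * z) *
      (qinf (nome τ) (nome τ) * qinf (nome τ * Complex.exp (2 * Complex.I * z)) (nome τ) *
        qinf (Complex.exp (-(2 * Complex.I * z))) (nome τ))) := by
  unfold theta1
  simp only [theta1_term]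
  rw [tsum_mul_left, jtp_s9 (nome_ne τ) (nome_lt hτ)
    (mul_ne_zero (nome_ne τ) (Complex.exp_ne_zero (2 * Complex.I * z)))
    (wth_zero z τ) (wth_step z τ)]
  congr 4
  rw [Complex.exp_neg]
  have := nome_ne τ
  have := Complex.exp_ne_zero (2 * Complex.I * z)
  field_simp

lemma eta_prod (τ : ℂ) :
    dedekindEta τ = Complex.exp (Real.pi * Complex.I * τ / 12) * qinf (nome τ) (nome τ) := by
  unfold dedekindEta qinf
  congr 2
  ext k
  congr 1
  unfold nome
  rw [← Complex.exp_nat_mul, ← Complex.exp_add]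
  congr 1
  ring

lemma eta_ne {τ : ℂ} (hτ : 0 < τ.im) : dedekindEta τ ≠ 0 := by
  rw [eta_prod]
  exact mul_ne_zero (Complex.exp_ne_zero _) (qinf_ne (nome_lt hτ))

lemma pow3_lt {q : ℂ} (hq : ‖q‖ < 1) : ‖q ^ 3‖ < 1 := by
  rw [norm_pow]; exact pow_lt_one₀ (norm_nonneg _) hq (by norm_num)

lemma qinf_triple {q ω : ℂ} (hq : ‖q‖ < 1) (hω : 1 + ω + ω ^ 2 = 0) (a : ℂ) :
    qinf a q * qinf (a * ω) q * qinf (a * ω ^ 2) q = qinf (a ^ 3) (q ^ 3) := by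
  have T := ((qinf_tendsto hq a).mul (qinf_tendsto hq (a * ω))).mul (qinf_tendsto hq (a * ω ^ 2))
  refine tendsto_nhds_unique T ((qinf_tendsto (pow3_lt hq) (a ^ 3)).congr fun n => ?_)
  rw [← Finset.prod_mul_distrib, ← Finset.prod_mul_distrib]
  refine Finset.prod_congr rfl fun k _ => ?_
  rw [← pow_mul, mul_comm 3 k, pow_mul]
  generalize q ^ k = Q
  have h3 : ω ^ 3 = 1 := by linear_combination (ω - 1) * hω
  linear_combination ((a * Q) - (a * Q) ^ 2 * ω) * hω + (a * Q) ^ 3 * h3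

lemma euler_split {q : ℂ} (hq : ‖q‖ < 1) :
    qinf (q ^ 3) (q ^ 3) * qinf q (q ^ 3) * qinf (q ^ 2) (q ^ 3) = qinf q q := by
  have h3 := pow3_lt hq
  have T := ((qinf_tendsto h3 (q ^ 3)).mul (qinf_tendsto h3 q)).mul (qinf_tendsto h3 (q ^ 2))
  have h : Tendsto (fun n : ℕ => 3 * n) atTop atTop := tendsto_id.const_mul_atTop' (by norm_num)
  refine tendsto_nhds_unique T (((qinf_tendsto hq q).comp h).congr fun n => ?_)
  rw [← Finset.prod_mul_distrib, ← Finset.prod_mul_distrib]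
  simp only [Function.comp]
  induction n with
  | zero => simp
  | succ n ih =>
    rw [Finset.prod_range_succ, ← ih, show 3 * (n + 1) = 3 * n + 1 + 1 + 1 by ring,
      Finset.prod_range_succ, Finset.prod_range_succ, Finset.prod_range_succ]
    ring

lemma theta1_triple {τ : ℂ} (hτ : 0 < τ.im) (x : ℂ) :
    theta1 x τ * theta1 (x + Real.pi / 3) τ * theta1 (x + 2 * (Real.pi / 3)) τ *
      dedekindEta (3 * τ) = theta1 (3 * x) (3 * τ) * dedekindEta τ ^ 3 := by
  have hτ3 : 0 < (3 * τ).im := by simpa using hτ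
  rw [theta1_prod hτ, theta1_prod hτ, theta1_prod hτ, theta1_prod hτ3, eta_prod, eta_prod,
    nome_three]
  obtain ⟨ω, hωd⟩ : ∃ ω, ω = Complex.exp (2 * Real.pi * Complex.I / 3) := ⟨_, rfl⟩
  have hprim : IsPrimitiveRoot ω 3 := by
    rw [hωd]; exact_mod_cast Complex.isPrimitiveRoot_exp 3 (by norm_num)
  have h3 : ω ^ 3 = 1 := hprim.pow_eq_one
  have hω : 1 + ω + ω ^ 2 = 0 := by
    have := hprim.geom_sum_eq_zero (by norm_num)
    simpa [Finset.sum_range_succ] using this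
  have hω0 : ω ≠ 0 := hprim.ne_zero (by norm_num)
  have hq := nome_lt hτ
  obtain ⟨E, hE⟩ : ∃ E, E = Complex.exp (2 * Complex.I * x) := ⟨_, rfl⟩
  obtain ⟨F, hF⟩ : ∃ F, F = Complex.exp (-(2 * Complex.I * x)) := ⟨_, rfl⟩
  have e1 : Complex.exp (2 * Complex.I * (x + Real.pi / 3)) = E * ω := by
    rw [hE, hωd, ← Complex.exp_add]; congr 1; ring
  have e2 : Complex.exp (2 * Complex.I * (x + 2 * (Real.pi / 3))) = E * ω ^ 2 := by
    rw [hE, hωd, ← Complex.exp_nat_mul, ← Complex.exp_add]; congr 1; push_cast; ring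
  have hi1 : ω⁻¹ = ω ^ 2 := by field_simp; exact h3.symm
  have f1 : Complex.exp (-(2 * Complex.I * (x + Real.pi / 3))) = F * ω ^ 2 := by
    rw [hF, ← hi1, hωd, ← Complex.exp_neg, ← Complex.exp_add]; congr 1; ring
  have f2 : Complex.exp (-(2 * Complex.I * (x + 2 * (Real.pi / 3)))) = F * ω := by
    have : ω = (ω ^ 2)⁻¹ := by rw [← hi1, inv_inv]
    rw [hF, this, hωd, ← Complex.exp_nat_mul, ← Complex.exp_neg, ← Complex.exp_add]
    congr 1; push_cast; ring
  have e3 : Complex.exp (2 * Complex.I * (3 * x)) = E ^ 3 := by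
    rw [hE, ← Complex.exp_nat_mul]; congr 1; push_cast; ring
  have f3 : Complex.exp (-(2 * Complex.I * (3 * x))) = F ^ 3 := by
    rw [hF, ← Complex.exp_nat_mul]; congr 1; push_cast; ring
  rw [e1, e2, f1, f2, e3, f3, ← hE, ← hF]
  have A1 := qinf_triple hq hω (nome τ * E)
  have A2 := qinf_triple hq hω F
  rw [← mul_pow, ← A1, ← A2]
  have g1 : Complex.exp (Complex.I * (x + Real.pi / 3)) * Complex.exp (Complex.I * (x + 2 * (Real.pi / 3)))
      * Complex.exp (Complex.I * x) = - Complex.exp (Complex.I * (3 * x)) := by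
    rw [← Complex.exp_add, ← Complex.exp_add, ← neg_one_mul, ← Complex.exp_pi_mul_I,
      ← Complex.exp_add]
    congr 1; ring
  have g2 : Complex.exp (Real.pi * Complex.I * (3 * τ) / 4) =
      Complex.exp (Real.pi * Complex.I * τ / 4) ^ 3 := by
    rw [← Complex.exp_nat_mul]; congr 1; push_cast; ring
  have g3 : Complex.exp (Real.pi * Complex.I * (3 * τ) / 12) =
      Complex.exp (Real.pi * Complex.I * τ / 12) ^ 3 := by
    rw [← Complex.exp_nat_mul]; congr 1; push_cast; ring
  rw [g2, g3]
  have hI : Complex.I ^ 2 = -1 := Complex.I_sq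
  rw [← mul_assoc (nome τ) E ω, ← mul_assoc (nome τ) E (ω ^ 2)]
  generalize qinf (nome τ * E) (nome τ) = u0
  generalize qinf (nome τ * E * ω) (nome τ) = u1
  generalize qinf (nome τ * E * ω ^ 2) (nome τ) = u2
  generalize qinf F (nome τ) = v0
  generalize qinf (F * ω) (nome τ) = v1
  generalize qinf (F * ω ^ 2) (nome τ) = v2
  generalize qinf (nome τ) (nome τ) = Q
  generalize qinf (nome τ ^ 3) (nome τ ^ 3) = Q3
  generalize Complex.exp (Real.pi * Complex.I * τ / 4) = S at *
  generalize Complex.exp (Real.pi * Complex.I * τ / 12) = R at *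
  generalize Complex.exp (Complex.I * (x + Real.pi / 3)) = X1 at *
  generalize Complex.exp (Complex.I * (x + 2 * (Real.pi / 3))) = X2 at *
  generalize Complex.exp (Complex.I * x) = X0 at *
  generalize Complex.exp (Complex.I * (3 * x)) = X3 at *
  have hI3 : Complex.I ^ 3 = - Complex.I := Complex.I_pow_three
  generalize Complex.I = i at *
  have hX3 : X3 = -(X1 * X2 * X0) := by rw [g1, neg_neg]
  rw [hX3]
  linear_combination (-(S ^ 3 * X0 * X1 * X2 * Q ^ 3 * u0 * u1 * u2 * v0 * v1 * v2 * R ^ 3 * Q3)) * hI3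

lemma euler_sum {τ : ℂ} (hτ : 0 < τ.im) :
    ∑' n : ℤ, (-1 : ℂ) ^ n * Complex.exp (Real.pi * Complex.I * τ * (3 * n ^ 2 - n + 1 / 12)) =
      dedekindEta τ := by
  have hq := nome_lt hτ
  have h0 := nome_ne τ
  have := jtp_s9 (q := nome τ ^ 3) (z := nome τ) (pow_ne_zero 3 h0) (pow3_lt hq) h0
    (w := fun n : ℤ => (-1 : ℂ) ^ n * Complex.exp (Real.pi * Complex.I * τ * (3 * n ^ 2 - n)))
    (by simp) (by
      intro j
      rw [← nome_three, nome_zpow]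
      unfold nome
      rw [zpow_add_one₀ (by norm_num)]
      have : ∀ a b c s : ℂ, -(Complex.exp a) * Complex.exp b * (s * Complex.exp c) =
          s * (-1) * Complex.exp (a + b + c) := by
        intros; simp only [Complex.exp_add]; ring
      rw [this]
      congr 2
      push_cast
      ring)
  rw [show nome τ ^ 3 / nome τ = nome τ ^ 2 by field_simp, euler_split hq] at this
  rw [eta_prod, ← this, ← tsum_mul_left]
  refine tsum_congr fun n => ?_
  have : ∀ a b s : ℂ, Complex.exp a * (s * Complex.exp b) = s * Complex.exp (a + b) := by
    intros; simp only [Complex.exp_add]; ring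
  rw [this]
  congr 2
  ring

/-- The summand of `theta1`. -/
noncomputable def tht (z τ : ℂ) (n : ℤ) : ℂ :=
  (-1 : ℂ) ^ n * Complex.exp (Real.pi * Complex.I * τ * (2 * (n : ℂ) + 1) ^ 2 / 4) *
    Complex.exp ((2 * (n : ℂ) + 1) * Complex.I * z)

lemma tht_summable {τ : ℂ} (hτ : 0 < τ.im) (z : ℂ) : Summable (tht z τ) := by
  have := (wth_summable hτ z).mul_left
    (Complex.exp (Real.pi * Complex.I * τ / 4) * Complex.exp (Complex.I * z))
  refine this.congr fun n => ?_
  exact (theta1_term z τ n).symm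

/-- The summand of the product of three theta functions. -/
noncomputable def tri (x y τ : ℂ) (p : (ℤ × ℤ) × ℤ) : ℂ :=
  tht x τ p.1.1 * tht y τ p.1.2 * tht (x + y) τ p.2

lemma tri_summable {τ : ℂ} (hτ : 0 < τ.im) (x y : ℂ) : Summable (tri x y τ) := by
  have h1 := (tht_summable hτ x).norm
  have h2 := (tht_summable hτ y).norm
  have h3 := (tht_summable hτ (x + y)).norm
  have h12 : Summable fun p : ℤ × ℤ => ‖tht x τ p.1 * tht y τ p.2‖ :=
    (summable_mul_of_summable_norm h1 h2).norm
  have := summable_mul_of_summable_norm (f := fun p : ℤ × ℤ => tht x τ p.1 * tht y τ p.2)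
    (g := tht (x + y) τ) h12 h3
  refine this.congr fun p => ?_
  rfl

lemma theta_mul3 {τ : ℂ} (hτ : 0 < τ.im) (x y : ℂ) :
    theta1 x τ * theta1 y τ * theta1 (x + y) τ = Complex.I * ∑' p, tri x y τ p := by
  have h1 := (tht_summable hτ x).norm
  have h2 := (tht_summable hτ y).norm
  have h3 := (tht_summable hτ (x + y)).norm
  have h12 := summable_mul_of_summable_norm h1 h2
  have e12 := tsum_mul_tsum_of_summable_norm h1 h2
  have e := tsum_mul_tsum_of_summable_norm h12.norm h3
  have e' : ∑' p, tri x y τ p = (∑' n, tht x τ n) * (∑' n, tht y τ n) * ∑' n, tht (x + y) τ n := by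
    rw [e12, e]; rfl
  rw [e']
  have t : ∀ z, theta1 z τ = -Complex.I * ∑' n, tht z τ n := fun z => rfl
  rw [t, t, t]
  linear_combination (-((∑' n, tht x τ n) * (∑' n, tht y τ n) * ∑' n, tht (x + y) τ n)) *
    Complex.I_pow_three

/-- The reindexing of `ℤ³`. -/
def reidx (c : ((ℤ × ℤ) × Fin 3) × ℤ) : (ℤ × ℤ) × ℤ :=
  ((c.1.1.2 - c.2 + ((c.1.2 : ℕ) : ℤ) - 2, c.1.1.1 - c.2 + ((c.1.2 : ℕ) : ℤ) - 2),
    c.2 + c.1.1.1 + c.1.1.2)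

lemma reidx_bij : Function.Bijective reidx := by
  constructor
  · rintro ⟨⟨⟨k, l⟩, c⟩, n⟩ ⟨⟨⟨k', l'⟩, c'⟩, n'⟩ h
    simp only [reidx, Prod.mk.injEq] at h
    obtain ⟨⟨h1, h2⟩, h3⟩ := h
    have := c.2
    have := c'.2
    simp only [Prod.mk.injEq, Fin.ext_iff]
    omega
  · rintro ⟨⟨a, b⟩, m⟩
    -- `a + b + 2m + 4 = 3 (k + l) + 2 c`
    let s : ℤ := a + b + 2 * m + 4
    let c : ℤ := (2 * s) % 3
    let S : ℤ := (s - 2 * c) / 3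
    have hc : 0 ≤ c ∧ c < 3 := by omega
    refine ⟨⟨⟨⟨(S + b - a) / 2, (S + a - b) / 2⟩, ⟨c.toNat, by omega⟩⟩, m - S⟩, ?_⟩
    simp only [reidx, Prod.mk.injEq]
    omega

/-- One-dimensional inner sum. -/
noncomputable def inn (τ c : ℂ) (n : ℤ) : ℂ :=
  (-1 : ℂ) ^ n * Complex.exp (Real.pi * Complex.I * τ * (3 / 4 * (2 * n + 1 - 4 / 3 * c) ^ 2))

/-- Two-dimensional outer summand. -/
noncomputable def out (x y τ c : ℂ) (p : ℤ × ℤ) : ℂ :=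
  Complex.exp (2 * Complex.I * Real.pi * τ *
      ((p.1 : ℂ) ^ 2 + (p.1 : ℂ) * (p.2 : ℂ) + (p.2 : ℂ) ^ 2 + c * (p.1 + p.2) + c ^ 2 / 3)) *
    Complex.exp (2 * Complex.I * x * (2 * (p.2 : ℂ) + (p.1 : ℂ) + c)) *
    Complex.exp (2 * Complex.I * y * (2 * (p.1 : ℂ) + (p.2 : ℂ) + c))

lemma tri_reidx (x y τ : ℂ) (p : ℤ × ℤ) (c : Fin 3) (n : ℤ) :
    tri x y τ (reidx ((p, c), n)) =
      out x y τ (((c : ℕ) : ℂ) - 1) p * inn τ (((c : ℕ) : ℂ) - 1) n := by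
  obtain ⟨k, l⟩ := p
  simp only [tri, reidx, tht, out, inn]
  have hm : (-1 : ℂ) ≠ 0 := by norm_num
  have sgn : (-1 : ℂ) ^ (l - n + ((c : ℕ) : ℤ) - 2) * (-1 : ℂ) ^ (k - n + ((c : ℕ) : ℤ) - 2) *
      (-1 : ℂ) ^ (n + k + l) = (-1 : ℂ) ^ n := by
    rw [← zpow_add₀ hm, ← zpow_add₀ hm]
    have : l - n + ((c : ℕ) : ℤ) - 2 + (k - n + ((c : ℕ) : ℤ) - 2) + (n + k + l) =
      n + 2 * (k + l - n + c - 2) := by ring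
    rw [this, zpow_add₀ hm, zpow_mul]
    simp
  have L : ∀ s1 s2 s3 a1 a2 a3 b1 b2 b3 : ℂ,
      s1 * Complex.exp a1 * Complex.exp b1 * (s2 * Complex.exp a2 * Complex.exp b2) *
      (s3 * Complex.exp a3 * Complex.exp b3) =
      (s1 * s2 * s3) * Complex.exp (a1 + a2 + a3 + b1 + b2 + b3) := by
    intros; simp only [Complex.exp_add]; ring
  have R : ∀ s a b c d : ℂ, Complex.exp a * Complex.exp b * Complex.exp c *
      (s * Complex.exp d) = s * Complex.exp (a + b + c + d) := by
    intros; simp only [Complex.exp_add]; ring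
  rw [L, R, sgn]
  congr 2
  push_cast
  ring

lemma inn_zero (τ : ℂ) : ∑' n, inn τ 0 n = 0 := by
  let e : ℤ ≃ ℤ := Equiv.subLeft (-1)
  have h := e.tsum_eq (inn τ 0)
  have h2 : ∀ n, inn τ 0 (e n) = - inn τ 0 n := by
    intro n
    simp only [inn, e, Equiv.subLeft_apply]
    have : (-1 : ℂ) ^ (-1 - n) = - (-1 : ℂ) ^ n := by
      rw [zpow_sub₀ (by norm_num), zpow_neg_one]
      rcases Int.even_or_odd n with h | h
      · simp [h.neg_one_zpow]
      · simp [h.neg_one_zpow]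
    rw [this, neg_mul]
    congr 3
    push_cast
    ring
  simp only [h2, tsum_neg] at h
  linear_combination (-1 / 2 : ℂ) * h

lemma inn_one {τ : ℂ} (hτ : 0 < τ.im) : ∑' n, inn τ 1 n = dedekindEta τ := by
  rw [← euler_sum hτ]
  refine tsum_congr fun n => ?_
  unfold inn
  congr 2
  ring

lemma inn_neg_one {τ : ℂ} (hτ : 0 < τ.im) : ∑' n, inn τ (-1) n = -dedekindEta τ := by
  rw [← euler_sum hτ, ← tsum_neg]
  let e : ℤ ≃ ℤ := Equiv.subLeft (-1)
  rw [← e.tsum_eq]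
  refine tsum_congr fun n => ?_
  simp only [inn, e, Equiv.subLeft_apply]
  have : (-1 : ℂ) ^ (-1 - n) = - (-1 : ℂ) ^ n := by
    rw [zpow_sub₀ (by norm_num), zpow_neg_one]
    rcases Int.even_or_odd n with h | h
    · simp [h.neg_one_zpow]
    · simp [h.neg_one_zpow]
  rw [this, neg_mul]
  congr 3
  push_cast
  ring

lemma theta_sum {τ : ℂ} (hτ : 0 < τ.im) (x y : ℂ) :
    Summable (out x y τ 1) ∧ Summable (out x y τ (-1)) ∧
    ∑' p, tri x y τ p = dedekindEta τ * (∑' p, out x y τ 1 p - ∑' p, out x y τ (-1) p) := by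
  have hη := eta_ne hτ
  let e := Equiv.ofBijective reidx reidx_bij
  have hs : Summable fun p => tri x y τ (e p) := e.summable_iff.mpr (tri_summable hτ x y)
  have he : ∀ p c n, tri x y τ (e ((p, c), n)) =
      out x y τ (((c : ℕ) : ℂ) - 1) p * inn τ (((c : ℕ) : ℂ) - 1) n :=
    fun p c n => tri_reidx x y τ p c n
  have hs2 := hs.prod
  simp only [he, tsum_mul_left] at hs2
  have e0 : ((0 : ℕ) : ℂ) - 1 = -1 := by norm_num
  have e1 : ((1 : ℕ) : ℂ) - 1 = 0 := by norm_num
  have e2 : ((2 : ℕ) : ℂ) - 1 = 1 := by norm_num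
  have s0 : Summable fun p : ℤ × ℤ => out x y τ (-1) p * -dedekindEta τ := by
    have := hs2.comp_injective (i := fun p : ℤ × ℤ => (p, (0 : Fin 3))) (by
      intro a b h; simpa using h)
    simpa [Function.comp_def, inn_neg_one hτ] using this
  have s2 : Summable fun p : ℤ × ℤ => out x y τ 1 p * dedekindEta τ := by
    have := hs2.comp_injective (i := fun p : ℤ × ℤ => (p, (2 : Fin 3))) (by
      intro a b h; simpa using h)
    simpa only [Function.comp_def, Fin.val_two, e2, inn_one hτ] using this
  refine ⟨(summable_mul_right_iff hη).mp s2,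
    (summable_mul_right_iff (neg_ne_zero.mpr hη)).mp s0, ?_⟩
  rw [← e.tsum_eq, hs.tsum_prod]
  simp only [he, tsum_mul_left]
  rw [hs2.tsum_prod]
  simp only [tsum_fintype, Fin.sum_univ_three, Fin.val_zero, Fin.val_one, Fin.val_two, e0, e1, e2,
    inn_zero, inn_one hτ, inn_neg_one hτ, mul_zero, add_zero]
  rw [s0.tsum_add s2, tsum_mul_right, tsum_mul_right]
  ring

lemma Cfun_pos {x y τ : ℂ} (h : Summable (out x y τ 1)) : Cfun x y τ = ∑' p, out x y τ 1 p := by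
  rw [h.tsum_prod]
  unfold Cfun
  rw [← tsum_mul_left]
  refine tsum_congr fun k => ?_
  rw [← tsum_mul_left]
  refine tsum_congr fun l => ?_
  simp only [out, ← Complex.exp_add]
  congr 1
  ring

lemma Cfun_neg {x y τ : ℂ} (h : Summable (out x y τ (-1))) :
    Cfun (-x) (-y) τ = ∑' p, out x y τ (-1) p := by
  have ee : ∀ p, out x y τ (-1) (Equiv.neg (ℤ × ℤ) p) = out (-x) (-y) τ 1 p := by
    rintro ⟨k, l⟩
    simp only [out, ← Complex.exp_add, Equiv.neg_apply, Prod.neg_mk]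
    congr 1
    push_cast
    ring
  have h' : Summable (out (-x) (-y) τ 1) :=
    ((Equiv.neg (ℤ × ℤ)).summable_iff (f := out x y τ (-1)) |>.mpr h).congr ee
  rw [Cfun_pos h', ← (Equiv.neg (ℤ × ℤ)).tsum_eq (out x y τ (-1))]
  exact tsum_congr fun p => (ee p).symm

lemma C_diff {τ : ℂ} (hτ : 0 < τ.im) (x y : ℂ) :
    theta1 x τ * theta1 y τ * theta1 (x + y) τ =
      Complex.I * dedekindEta τ * (Cfun x y τ - Cfun (-x) (-y) τ) := by
  obtain ⟨h1, h2, h3⟩ := theta_sum hτ x y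
  rw [theta_mul3 hτ, h3, Cfun_pos h1, Cfun_neg h2]
  ring

lemma C_shift (x y τ a : ℂ) (ω : ℂ) (ha : Complex.exp (2 * Complex.I * a) = ω) (h3 : ω ^ 3 = 1) :
    Cfun (x + a) (y + a) τ = ω ^ 2 * Cfun x y τ := by
  unfold Cfun
  rw [← mul_assoc]
  have e1 : Complex.exp (2 * Complex.I * (x + a + (y + a))) =
      ω ^ 2 * Complex.exp (2 * Complex.I * (x + y)) := by
    rw [← ha, ← Complex.exp_nat_mul, ← Complex.exp_add]; congr 1; push_cast; ring
  rw [e1]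
  congr 1
  refine tsum_congr fun k => tsum_congr fun l => ?_
  have e2 : Complex.exp (2 * Complex.I * a * (3 * ((k + l : ℤ) : ℂ))) = 1 := by
    have : 2 * Complex.I * a * (3 * ((k + l : ℤ) : ℂ)) =
      ((k + l : ℤ) : ℂ) * ((3 : ℕ) * (2 * Complex.I * a)) := by push_cast; ring
    rw [this, Complex.exp_int_mul, Complex.exp_nat_mul, ha, h3, one_zpow]
  rw [← mul_one (_ * Complex.exp (2 * Complex.I * y * (2 * k + l))), ← e2]
  simp only [← Complex.exp_add]
  congr 1
  push_cast
  ring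

lemma theta1_add_pi (z τ : ℂ) : theta1 (z + Real.pi) τ = -theta1 z τ := by
  unfold theta1
  rw [← mul_neg, ← tsum_neg]
  congr 1
  refine tsum_congr fun n => ?_
  have : Complex.exp ((2 * (n : ℂ) + 1) * Complex.I * (z + Real.pi)) =
      -Complex.exp ((2 * (n : ℂ) + 1) * Complex.I * z) := by
    have h : (2 * (n : ℂ) + 1) * Complex.I * (z + Real.pi) =
      (2 * (n : ℂ) + 1) * Complex.I * z + n * (2 * Real.pi * Complex.I) + Real.pi * Complex.I := by
      ring
    rw [h, Complex.exp_add, Complex.exp_add, Complex.exp_int_mul_two_pi_mul_I, Complex.exp_pi_mul_I]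
    ring
  rw [this]
  ring

/-- `C(x,y|τ)³ − C(−x,−y|τ)³ = −i (η(τ)⁶/η(3τ)³) θ₁(3x|3τ) θ₁(3y|3τ) θ₁(3x+3y|3τ)`. -/
theorem C_cube_difference (τ : ℂ) (hτ : 0 < τ.im) (x y : ℂ) :
    Cfun x y τ ^ 3 - Cfun (-x) (-y) τ ^ 3
      = -Complex.I * (dedekindEta τ ^ 6 / dedekindEta (3 * τ) ^ 3) *
          theta1 (3 * x) (3 * τ) * theta1 (3 * y) (3 * τ) * theta1 (3 * x + 3 * y) (3 * τ) := by
  have hη := eta_ne hτ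
  have hτ3 : 0 < (3 * τ).im := by simpa using hτ
  have hη3 := eta_ne hτ3
  obtain ⟨a, had⟩ : ∃ a : ℂ, a = Real.pi / 3 := ⟨_, rfl⟩
  obtain ⟨ω, hωd⟩ : ∃ ω, ω = Complex.exp (2 * Complex.I * a) := ⟨_, rfl⟩
  have hprim : IsPrimitiveRoot ω 3 := by
    have : 2 * Complex.I * a = 2 * Real.pi * Complex.I / (3 : ℕ) := by
      rw [had]; push_cast; ring
    rw [hωd, this]; exact Complex.isPrimitiveRoot_exp 3 (by norm_num)
  have h3 : ω ^ 3 = 1 := hprim.pow_eq_one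
  have hω : 1 + ω + ω ^ 2 = 0 := by
    have := hprim.geom_sum_eq_zero (by norm_num)
    simpa [Finset.sum_range_succ] using this
  have hω0 : ω ≠ 0 := hprim.ne_zero (by norm_num)
  have hi1 : ω⁻¹ = ω ^ 2 := by field_simp; exact h3.symm
  have ha1 : Complex.exp (2 * Complex.I * -a) = ω ^ 2 := by
    rw [← hi1, hωd, ← Complex.exp_neg]; congr 1; ring
  have h32 : (ω ^ 2) ^ 3 = 1 := by rw [← pow_mul, mul_comm, pow_mul, h3, one_pow]
  have S1 := C_shift x y τ a ω hωd.symm h3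
  have S2 := C_shift (x + a) (y + a) τ a ω hωd.symm h3
  have T1 := C_shift (-x) (-y) τ (-a) (ω ^ 2) ha1 h32
  have T2 := C_shift (-x + -a) (-y + -a) τ (-a) (ω ^ 2) ha1 h32
  have D0 := C_diff hτ x y
  have D1 := C_diff hτ (x + a) (y + a)
  have D2 := C_diff hτ (x + a + a) (y + a + a)
  rw [neg_add, neg_add, S1, T1] at D1
  rw [neg_add, neg_add, neg_add, neg_add, S2, T2, S1, T1] at D2
  have X := theta1_triple hτ x
  have Y := theta1_triple hτ y
  have Z := theta1_triple hτ (x + y)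
  rw [← had] at X Y Z
  have x2 : x + 2 * a = x + a + a := by ring
  have y2 : y + 2 * a = y + a + a := by ring
  have z1 : x + a + (y + a) = x + y + 2 * a := by ring
  have z2 : theta1 (x + a + a + (y + a + a)) τ = - theta1 (x + y + a) τ := by
    rw [← theta1_add_pi]; congr 1; rw [had]; ring
  rw [x2] at X
  rw [y2] at Y
  rw [z1] at D1
  rw [z2] at D2
  rw [mul_add] at Z
  generalize theta1 (3 * x) (3 * τ) = X3 at *
  generalize theta1 (3 * y) (3 * τ) = Y3 at *
  generalize theta1 (3 * x + 3 * y) (3 * τ) = Z3 at *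
  generalize theta1 x τ = X0 at *
  generalize theta1 (x + a) τ = X1 at *
  generalize theta1 (x + a + a) τ = X2 at *
  generalize theta1 y τ = Y0 at *
  generalize theta1 (y + a) τ = Y1 at *
  generalize theta1 (y + a + a) τ = Y2 at *
  generalize theta1 (x + y) τ = Z0 at *
  generalize theta1 (x + y + a) τ = Z1 at *
  generalize theta1 (x + y + 2 * a) τ = Z2 at *
  generalize dedekindEta τ = H at *
  generalize dedekindEta (3 * τ) = H3 at *
  generalize Cfun x y τ = A at *
  generalize Cfun (-x) (-y) τ = B at *
  have hI3 : Complex.I ^ 3 = - Complex.I := Complex.I_pow_three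
  have hI2 : Complex.I ^ 2 = -1 := Complex.I_sq
  generalize Complex.I = i at *
  have P1 : (X0 * X1 * X2 * H3) * (Y0 * Y1 * Y2 * H3) * (Z0 * Z1 * Z2 * H3) =
      (X3 * H ^ 3) * (Y3 * H ^ 3) * (Z3 * H ^ 3) := by rw [X, Y, Z]
  have P2 : (X0 * Y0 * Z0) * (X1 * Y1 * Z2) * (X2 * Y2 * -Z1) = i ^ 3 * H ^ 3 * (A ^ 3 - B ^ 3) := by
    have h4 : (ω ^ 2) ^ 2 = ω := by linear_combination ω * h3
    rw [D0, D1, D2, h4]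
    linear_combination (i ^ 3 * H ^ 3 * (A - B) * (A ^ 2 * (ω ^ 3 + 1) - A * B * ω + B ^ 2 - A * B * (ω ^ 2))) * h3 - (i ^ 3 * H ^ 3 * (A - B) * A * B) * hω
  have P3 : H ^ 3 * (i * H3 ^ 3 * (A ^ 3 - B ^ 3)) = H ^ 3 * (H ^ 6 * X3 * Y3 * Z3) := by
    rw [hI3] at P2
    linear_combination P1 + H3 ^ 3 * P2
  have P4 := mul_left_cancel₀ (pow_ne_zero 3 hη) P3
  field_simp
  linear_combination (-i) * P4 + H3 ^ 3 * (A ^ 3 - B ^ 3) * hI2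
end

section
/- Let τ ∈ ℂ with Im τ > 0, write q = exp(iπτ), and let x, y ∈ ℂ. Then A(x,y|3τ) − C(x,y|3τ) = ∏_{k=1}^∞ (1−q^{6k})²·(1−q^{6k−2}e^{2ix})·(1−q^{6k−4}e^{−2ix})·(1−q^{6k−2}e^{2iy})·(1−q^{6k−4}e^{−2iy})·(1−q^{6k−2}e^{−2i(x+y)})·(1−q^{6k−4}e^{2i(x+y)}). -/
open Complex

/-- The theta series A(x,y|τ). -/
noncomputable def Afun (x y τ : ℂ) : ℂ :=
  ∑' k : ℤ, ∑' l : ℤ,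
    Complex.exp (2 * Complex.I * Real.pi * τ * ((k : ℂ) ^ 2 + (k : ℂ) * (l : ℂ) + (l : ℂ) ^ 2)) *
    Complex.exp (2 * Complex.I * x * (2 * (l : ℂ) + (k : ℂ))) *
    Complex.exp (2 * Complex.I * y * (2 * (k : ℂ) + (l : ℂ)))

noncomputable def PP (Q : ℂ) (m : ℕ) : ℂ := ∏ j ∈ Finset.range m, (1 - Q ^ (j + 1))

noncomputable def RR (Q : ℂ) (m : ℤ) : ℂ := if 0 ≤ m then (PP Q m.toNat)⁻¹ else 0

lemma one_sub_pow_ne_s13 {Q : ℂ} (hQ : ‖Q‖ < 1) (j : ℕ) : 1 - Q ^ (j + 1) ≠ 0 := by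
  intro h
  have h1 : Q ^ (j + 1) = 1 := (sub_eq_zero.mp h).symm
  have h2 : ‖Q‖ ^ (j + 1) = 1 := by rw [← norm_pow, h1, norm_one]
  have h3 := pow_lt_one₀ (norm_nonneg Q) hQ (Nat.succ_ne_zero j)
  exact absurd h2 h3.ne

lemma RR_rec {Q : ℂ} (hQ : ‖Q‖ < 1) (m : ℤ) : RR Q (m - 1) = (1 - Q ^ m) * RR Q m := by
  unfold RR
  rcases lt_trichotomy m 0 with h | h | h
  · rw [if_neg (by omega), if_neg (by omega), mul_zero]
  · subst h; simp
  · obtain ⟨k, rfl⟩ : ∃ k : ℕ, m = k + 1 := ⟨(m - 1).toNat, by omega⟩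
    rw [if_pos (by omega), if_pos (by omega)]
    have e1 : ((k : ℤ) + 1 - 1).toNat = k := by omega
    have e2 : ((k : ℤ) + 1).toNat = k + 1 := by omega
    have e3 : Q ^ ((k : ℤ) + 1) = Q ^ (k + 1) := by exact_mod_cast zpow_natCast Q (k + 1)
    rw [e1, e2, e3]
    unfold PP
    rw [Finset.prod_range_succ]
    have := one_sub_pow_ne_s13 hQ k
    rw [mul_inv]
    field_simp

noncomputable def cc (Q : ℂ) (N : ℕ) (n : ℤ) : ℂ := PP Q (2 * N) * RR Q (N + n) * RR Q (N - n)

lemma cc_rec {q : ℂ} (hq0 : q ≠ 0) (hq : ‖q‖ < 1) (N : ℕ) (n : ℤ) :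
    cc (q ^ 2) (N + 1) n * q ^ (n ^ 2) = (1 + q ^ (4 * N + 2)) * (cc (q ^ 2) N n * q ^ (n ^ 2))
      + q ^ (2 * N + 1) * (cc (q ^ 2) N (n - 1) * q ^ ((n - 1) ^ 2)
        + cc (q ^ 2) N (n + 1) * q ^ ((n + 1) ^ 2)) := by
  have hQ : ‖q ^ 2‖ < 1 := by
    rw [norm_pow]; exact pow_lt_one₀ (norm_nonneg q) hq two_ne_zero
  have hQ0 : q ^ 2 ≠ 0 := pow_ne_zero 2 hq0
  set a : ℤ := N + 1 + n with ha
  set b : ℤ := N + 1 - n with hb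
  have hrec := RR_rec hQ
  have a1 := hrec a
  have a2 := hrec (a - 1)
  have b1 := hrec b
  have b2 := hrec (b - 1)
  have c0 : cc (q ^ 2) (N + 1) n = PP (q ^ 2) (2 * N) * (1 - (q ^ 2) ^ (2 * N + 1)) *
      (1 - (q ^ 2) ^ (2 * N + 2)) * RR (q ^ 2) a * RR (q ^ 2) b := by
    unfold cc
    have : 2 * (N + 1) = 2 * N + 1 + 1 := by ring
    rw [this]
    unfold PP
    rw [Finset.prod_range_succ, Finset.prod_range_succ]
    push_cast
    rw [← ha, ← hb]
  have c1 : cc (q ^ 2) N n = PP (q ^ 2) (2 * N) * RR (q ^ 2) (a - 1) * RR (q ^ 2) (b - 1) := by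
    unfold cc
    rw [show (N : ℤ) + n = a - 1 by omega, show (N : ℤ) - n = b - 1 by omega]
  have c2 : cc (q ^ 2) N (n - 1) = PP (q ^ 2) (2 * N) * RR (q ^ 2) (a - 1 - 1) * RR (q ^ 2) b := by
    unfold cc
    rw [show (N : ℤ) + (n - 1) = a - 1 - 1 by omega, show (N : ℤ) - (n - 1) = b by omega]
  have c3 : cc (q ^ 2) N (n + 1) = PP (q ^ 2) (2 * N) * RR (q ^ 2) a * RR (q ^ 2) (b - 1 - 1) := by
    unfold cc
    rw [show (N : ℤ) + (n + 1) = a by omega, show (N : ℤ) - (n + 1) = b - 1 - 1 by omega]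
  rw [c0, c1, c2, c3, a2, a1, b2, b1]
  have e1 : q ^ (2 * N + 1) * q ^ ((n - 1) ^ 2) = (q ^ 2) ^ b * q ^ (n ^ 2) := by
    rw [← zpow_natCast q (2 * N + 1), ← zpow_natCast q 2, ← zpow_mul, ← zpow_add₀ hq0,
      ← zpow_add₀ hq0]
    congr 1; rw [hb]; push_cast; ring
  have e2 : q ^ (2 * N + 1) * q ^ ((n + 1) ^ 2) = (q ^ 2) ^ a * q ^ (n ^ 2) := by
    rw [← zpow_natCast q (2 * N + 1), ← zpow_natCast q 2, ← zpow_mul, ← zpow_add₀ hq0,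
      ← zpow_add₀ hq0]
    congr 1; rw [ha]; push_cast; ring
  have e3 : (q ^ 2) ^ a * (q ^ 2) ^ b = (q ^ 2) ^ (2 * N + 2) := by
    rw [← zpow_add₀ hQ0, ← zpow_natCast (q ^ 2) (2 * N + 2)]
    congr 1; rw [ha, hb]; push_cast; ring
  have e4 : q ^ (4 * N + 2) = (q ^ 2) ^ (2 * N + 1) := by rw [← pow_mul]; congr 1; ring
  have e5 : (q ^ 2) ^ (a - 1) * q ^ 2 = (q ^ 2) ^ a := by
    rw [zpow_sub_one₀ hQ0]; field_simp
  have e6 : (q ^ 2) ^ (b - 1) * q ^ 2 = (q ^ 2) ^ b := by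
    rw [zpow_sub_one₀ hQ0]; field_simp
  have e7 : (q ^ 2) ^ (2 * N + 2) = (q ^ 2) ^ (2 * N + 1) * q ^ 2 := by ring
  rw [e7] at e3 ⊢
  rw [e4, mul_add]
  rw [← e6] at e1
  rw [← e5] at e2
  rw [← e5, ← e6] at e3 ⊢
  generalize q ^ (2 * N + 1) = s at *
  generalize (q ^ 2) ^ (2 * N + 1) = S at *
  generalize (q ^ 2) ^ (a - 1) = A at *
  generalize (q ^ 2) ^ (b - 1) = B at *
  have e3' : A * B * q ^ 2 = S := by
    apply mul_right_cancel₀ hQ0; linear_combination e3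
  generalize q ^ ((n - 1) ^ 2) = t1 at *
  generalize q ^ ((n + 1) ^ 2) = t2 at *
  generalize q ^ (n ^ 2) = t at *
  generalize RR (q ^ 2) a = x at *
  generalize RR (q ^ 2) b = y at *
  generalize PP (q ^ 2) (2 * N) = P at *
  subst e3'
  linear_combination (-(P * x * y * (1 - A * q ^ 2) * (1 - A))) * e1
    - (P * x * y * (1 - B * q ^ 2) * (1 - B)) * e2

lemma finite_jtp_s13 {q : ℂ} (hq0 : q ≠ 0) (hq : ‖q‖ < 1) {w : ℂ} (hw : w ≠ 0) (N : ℕ) :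
    HasSum (fun n : ℤ => cc (q ^ 2) N n * q ^ (n ^ 2) * w ^ n)
      (∏ k ∈ Finset.range N, ((1 + w * q ^ (2 * k + 1)) * (1 + w⁻¹ * q ^ (2 * k + 1)))) := by
  induction N with
  | zero =>
    have h := hasSum_single (f := fun n : ℤ => cc (q ^ 2) 0 n * q ^ (n ^ 2) * w ^ n) 0 (by
      intro n hn
      have : cc (q ^ 2) 0 n = 0 := by
        unfold cc RR
        rcases lt_or_gt_of_ne hn with h | h
        · rw [if_neg (by simpa using h)]; simp
        · rw [if_neg (c := 0 ≤ ((0 : ℕ) : ℤ) - n) (by simpa using h)]; simp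
      simp [this])
    simpa [cc, RR, PP] using h
  | succ N ih =>
    have h1 := (Equiv.subRight (1 : ℤ)).hasSum_iff.mpr ih
    have h2 := (Equiv.addRight (1 : ℤ)).hasSum_iff.mpr ih
    have h3 := (ih.mul_left (1 + q ^ (4 * N + 2))).add
      (((h1.mul_left w).add (h2.mul_left w⁻¹)).mul_left (q ^ (2 * N + 1)))
    rw [Finset.prod_range_succ]
    generalize ∏ k ∈ Finset.range N, ((1 + w * q ^ (2 * k + 1)) * (1 + w⁻¹ * q ^ (2 * k + 1)))
      = T at *
    have e : (1 + q ^ (4 * N + 2)) * T + q ^ (2 * N + 1) * (w * T + w⁻¹ * T) =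
        T * ((1 + w * q ^ (2 * N + 1)) * (1 + w⁻¹ * q ^ (2 * N + 1))) := by
      field_simp
      ring
    rw [e] at h3
    refine h3.congr_fun ?_
    intro n
    rw [cc_rec hq0 hq]
    simp only [Function.comp, Equiv.subRight_apply, Equiv.coe_addRight]
    rw [zpow_sub_one₀ hw, zpow_add_one₀ hw]
    field_simp

lemma summable_theta {q : ℂ} (hq0 : q ≠ 0) (hq : ‖q‖ < 1) {w : ℂ} (hw : w ≠ 0) :
    Summable (fun n : ℤ => q ^ (n ^ 2) * w ^ n) := by
  have hpi : (Real.pi : ℂ) * I ≠ 0 := by simp [Real.pi_ne_zero]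
  set τ : ℂ := Complex.log q / (Real.pi * I) with hτ
  set z : ℂ := Complex.log w / (2 * (Real.pi * I)) with hz
  have h1 : q = cexp (Real.pi * I * τ) := by
    rw [hτ, mul_div_cancel₀ _ hpi, Complex.exp_log hq0]
  have h2 : w = cexp (2 * (Real.pi * I) * z) := by
    rw [hz, mul_div_cancel₀ _ (mul_ne_zero two_ne_zero hpi), Complex.exp_log hw]
  have him : 0 < τ.im := by
    rw [h1, Complex.norm_exp] at hq
    have : (Real.pi * I * τ).re = - (Real.pi * τ.im) := by simp
    rw [this, Real.exp_lt_one_iff] at hq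
    by_contra h
    have := mul_nonpos_of_nonneg_of_nonpos Real.pi_pos.le (not_lt.mp h)
    linarith
  have := (summable_jacobiTheta₂_term_iff z τ).mpr him
  convert this using 2 with n
  rw [h1, h2, ← Complex.exp_int_mul, ← Complex.exp_int_mul, ← Complex.exp_add, jacobiTheta₂_term]
  congr 1
  push_cast
  ring

lemma summable_aux {q : ℂ} (hq : ‖q‖ < 1) (w : ℂ) (a b : ℕ) (ha : 0 < a) :
    Summable (fun k : ℕ => ‖w * q ^ (a * k + b)‖) := by
  have h : ‖q ^ a‖ < 1 := by
    rw [norm_pow]; exact pow_lt_one₀ (norm_nonneg q) hq ha.ne'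
  have := ((summable_geometric_of_norm_lt_one h).norm).mul_left ‖w * q ^ b‖
  refine this.congr fun k => ?_
  rw [← norm_mul]
  congr 1
  rw [pow_add, pow_mul]; ring

lemma mult_aux {q : ℂ} (hq : ‖q‖ < 1) (w : ℂ) (a b : ℕ) (ha : 0 < a) :
    Multipliable (fun k : ℕ => 1 + w * q ^ (a * k + b)) :=
  multipliable_one_add_of_summable (summable_aux hq w a b ha)

lemma PP_lim {Q : ℂ} (hQ : ‖Q‖ < 1) : ∃ L : ℂ, L ≠ 0 ∧ L = ∏' k : ℕ, (1 - Q ^ (k + 1)) ∧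
    Filter.Tendsto (PP Q) Filter.atTop (nhds L) := by
  have hs := summable_aux hQ (-1) 1 1 one_pos
  have hm := mult_aux hQ (-1) 1 1 one_pos
  have e : (fun k : ℕ => 1 + (-1) * Q ^ (1 * k + 1)) = fun k => 1 - Q ^ (k + 1) := by
    funext k; simp [sub_eq_add_neg]
  refine ⟨_, ?_, rfl, ?_⟩
  · have := tprod_one_add_ne_zero_of_summable (f := fun k : ℕ => (-1) * Q ^ (1 * k + 1)) (by
      intro k
      have := one_sub_pow_ne_s13 hQ k
      simpa [sub_eq_add_neg] using this) hs
    rw [← e]; exact this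
  · rw [e] at hm
    exact hm.tendsto_prod_tprod_nat

theorem jtp_s13 {q : ℂ} (hq0 : q ≠ 0) (hq : ‖q‖ < 1) {w : ℂ} (hw : w ≠ 0) :
    ∑' n : ℤ, q ^ (n ^ 2) * w ^ n =
      ∏' k : ℕ, ((1 - q ^ (2 * k + 2)) *
        ((1 + w * q ^ (2 * k + 1)) * (1 + w⁻¹ * q ^ (2 * k + 1)))) := by
  have hQ : ‖q ^ 2‖ < 1 := by
    rw [norm_pow]; exact pow_lt_one₀ (norm_nonneg q) hq two_ne_zero
  obtain ⟨L, hL0, hL, hlim⟩ := PP_lim hQ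
  have hPinv : Filter.Tendsto (fun m => (PP (q ^ 2) m)⁻¹) Filter.atTop (nhds L⁻¹) := hlim.inv₀ hL0
  obtain ⟨K1, hK1⟩ := hlim.norm.bddAbove_range
  obtain ⟨K2, hK2⟩ := hPinv.norm.bddAbove_range
  have hK1' : ∀ m, ‖PP (q ^ 2) m‖ ≤ K1 := fun m => hK1 ⟨m, rfl⟩
  have hK2' : ∀ m, ‖RR (q ^ 2) m‖ ≤ K2 := by
    intro m
    have h0 : ∀ m : ℕ, ‖(PP (q ^ 2) m)⁻¹‖ ≤ K2 := fun m => hK2 ⟨m, rfl⟩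
    unfold RR
    split_ifs
    · exact h0 _
    · rw [norm_zero]; exact (norm_nonneg _).trans (h0 0)
  have hK1p : 0 ≤ K1 := (norm_nonneg _).trans (hK1' 0)
  have hK2p : 0 ≤ K2 := (norm_nonneg _).trans (hK2' 0)
  have hRlim : ∀ f : ℕ → ℤ, Filter.Tendsto f Filter.atTop Filter.atTop →
      Filter.Tendsto (fun N => RR (q ^ 2) (f N)) Filter.atTop (nhds L⁻¹) := by
    intro f hf
    have h1 : Filter.Tendsto (fun N => (f N).toNat) Filter.atTop Filter.atTop := by
      rw [Filter.tendsto_atTop] at hf ⊢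
      intro b
      filter_upwards [hf b] with N hN
      omega
    refine (hPinv.comp h1).congr' ?_
    filter_upwards [hf.eventually_ge_atTop 0] with N hN
    simp [RR, hN]
  have hc : ∀ n : ℤ, Filter.Tendsto (fun N : ℕ => cc (q ^ 2) N n) Filter.atTop (nhds L⁻¹) := by
    intro n
    have t1 : Filter.Tendsto (fun N : ℕ => 2 * N) Filter.atTop Filter.atTop :=
      Filter.tendsto_id.const_mul_atTop' two_pos
    have t2 : Filter.Tendsto (fun N : ℕ => (N : ℤ) + n) Filter.atTop Filter.atTop :=
      Filter.tendsto_atTop_add_const_right _ _ tendsto_natCast_atTop_atTop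
    have t3 : Filter.Tendsto (fun N : ℕ => (N : ℤ) - n) Filter.atTop Filter.atTop :=
      Filter.tendsto_atTop_add_const_right _ (-n) tendsto_natCast_atTop_atTop
    have := ((hlim.comp t1).mul (hRlim _ t2)).mul (hRlim _ t3)
    have e : L * L⁻¹ * L⁻¹ = L⁻¹ := by field_simp
    rw [e] at this
    exact this
  have hT := tendsto_tsum_of_dominated_convergence (𝓕 := Filter.atTop)
    (f := fun (N : ℕ) (n : ℤ) => cc (q ^ 2) N n * q ^ (n ^ 2) * w ^ n)
    (g := fun n : ℤ => L⁻¹ * q ^ (n ^ 2) * w ^ n)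
    (bound := fun n : ℤ => K1 * K2 * K2 * ‖q ^ (n ^ 2) * w ^ n‖)
    ((summable_theta hq0 hq hw).norm.mul_left _)
    (fun n => ((hc n).mul_const _).mul_const _)
    (Filter.Eventually.of_forall fun N n => by
      rw [mul_assoc, norm_mul]
      refine mul_le_mul_of_nonneg_right ?_ (norm_nonneg _)
      unfold cc
      rw [norm_mul, norm_mul]
      gcongr
      · exact hK1' _
      · exact hK2' _
      · exact hK2' _)
  simp_rw [(finite_jtp_s13 hq0 hq hw _).tsum_eq, mul_assoc L⁻¹, tsum_mul_left] at hT
  have m1 := mult_aux hq w 2 1 two_pos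
  have m2 := mult_aux hq w⁻¹ 2 1 two_pos
  have hT2 := (m1.mul m2).tendsto_prod_tprod_nat
  have hE := tendsto_nhds_unique hT hT2
  have m0 : Multipliable (fun k : ℕ => 1 - q ^ (2 * k + 2)) := by
    simpa [sub_eq_add_neg] using mult_aux hq (-1) 2 2 two_pos
  rw [m0.tprod_mul (m1.mul m2), ← hE]
  have : ∏' k : ℕ, (1 - q ^ (2 * k + 2)) = L := by
    rw [hL]; congr 1; funext k; rw [← pow_mul]; congr 2
  rw [this, mul_inv_cancel_left₀ hL0]

noncomputable def TT (q X : ℂ) (n : ℤ) : ℂ := (q ^ 3) ^ (n ^ 2) * (-(q * X)) ^ n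

lemma TT_eq {q X : ℂ} (hq0 : q ≠ 0) (n : ℤ) :
    TT q X n = (-1) ^ n * q ^ (3 * n ^ 2 + n) * X ^ n := by
  unfold TT
  rw [zpow_add₀ hq0, zpow_mul, neg_eq_neg_one_mul, mul_zpow, mul_zpow]
  norm_cast
  ring

lemma TT_triple {q X Y : ℂ} (hq0 : q ≠ 0) (hX : X ≠ 0) (hY : Y ≠ 0) (l k c : ℤ) :
    TT q X l * TT q Y k * TT q (X * Y)⁻¹ c =
      (-1) ^ (l + k + c) * q ^ (3 * (l ^ 2 + k ^ 2 + c ^ 2) + (l + k + c)) *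
        X ^ (l - c) * Y ^ (k - c) := by
  rw [TT_eq hq0, TT_eq hq0, TT_eq hq0]
  have h1 : (-1 : ℂ) ≠ 0 := by norm_num
  rw [show 3 * (l ^ 2 + k ^ 2 + c ^ 2) + (l + k + c) =
    (3 * l ^ 2 + l) + (3 * k ^ 2 + k) + (3 * c ^ 2 + c) by ring]
  rw [zpow_add₀ h1, zpow_add₀ h1,
    zpow_add₀ hq0 (3 * l ^ 2 + l + (3 * k ^ 2 + k)),
    zpow_add₀ hq0 (3 * l ^ 2 + l) (3 * k ^ 2 + k), zpow_sub₀ hX, zpow_sub₀ hY,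
    inv_zpow, mul_zpow]
  have := zpow_ne_zero c hX
  have := zpow_ne_zero c hY
  field_simp

lemma tsum_int_three {G : ℤ → ℂ} (hG : Summable G) :
    ∑' u, G u = ∑' d : ℤ, G (3 * d) + ∑' d : ℤ, G (3 * d + 1) + ∑' d : ℤ, G (3 * d + 2) := by
  have inj : ∀ r : ℤ, Function.Injective (fun d : ℤ => 3 * d + r) := by
    intro r a b h
    simp only at h
    omega
  have s0 : Summable fun d : ℤ => G (3 * d) := by
    simpa [Function.comp_def] using hG.comp_injective (inj 0)
  have s1 : Summable fun d : ℤ => G (3 * d + 1) := hG.comp_injective (inj 1)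
  have s2 : Summable fun d : ℤ => G (3 * d + 2) := hG.comp_injective (inj 2)
  have e := (Int.divModEquiv 3).symm
  rw [← (Int.divModEquiv 3).symm.tsum_eq G]
  have hs := (Int.divModEquiv 3).symm.summable_iff.mpr hG
  have := hs.tsum_prod
  simp only [Function.comp_def] at this
  rw [this]
  simp_rw [tsum_fintype, Fin.sum_univ_three]
  rw [← s0.tsum_add s1, ← (s0.add s1).tsum_add s2]
  congr 1
  funext d
  simp [Int.divModEquiv, mul_comm]

section main
variable {q X Y : ℂ}

noncomputable def AA (q X Y : ℂ) : ℂ :=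
  ∑' p : ℤ × ℤ, q ^ (6 * (p.1 ^ 2 + p.1 * p.2 + p.2 ^ 2)) * X ^ (2 * p.2 + p.1) * Y ^ (2 * p.1 + p.2)

noncomputable def CC (q X Y : ℂ) : ℂ :=
  ∑' p : ℤ × ℤ, q ^ (6 * (p.1 ^ 2 + p.1 * p.2 + p.2 ^ 2 + p.1 + p.2) + 2) *
    X ^ (2 * p.2 + p.1 + 1) * Y ^ (2 * p.1 + p.2 + 1)

noncomputable def BB (q X Y : ℂ) : ℂ :=
  ∑' p : ℤ × ℤ, q ^ (3 * (p.2 ^ 2 + (p.1 + 1) ^ 2 + (p.1 + p.2) ^ 2) + 1) *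
    X ^ (2 * p.2 + p.1) * Y ^ (2 * p.1 + p.2 + 1)

noncomputable def EE (q : ℂ) (d : ℤ) : ℂ := (q ^ 9) ^ (d ^ 2) * (-(q ^ 3)) ^ d

lemma EE_eq (hq0 : q ≠ 0) (d : ℤ) : EE q d = (-1) ^ d * q ^ (9 * d ^ 2 + 3 * d) := by
  unfold EE
  rw [zpow_add₀ hq0, zpow_mul, zpow_mul, neg_eq_neg_one_mul, mul_zpow]
  norm_cast
  ring

noncomputable def FF (q X Y : ℂ) (u : ℤ) (p : ℤ × ℤ) : ℂ :=
  TT q X p.2 * TT q Y p.1 * TT q (X * Y)⁻¹ (u - p.1 - p.2)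

lemma neg_one_zpow_three (d : ℤ) : (-1 : ℂ) ^ (3 * d) = (-1) ^ d := by
  rw [zpow_mul]; norm_num

lemma FF0 (hq0 : q ≠ 0) (hX : X ≠ 0) (hY : Y ≠ 0) (d : ℤ) (p : ℤ × ℤ) :
    FF q X Y (3 * d) (p + (d, d)) = EE q d *
      (q ^ (6 * (p.1 ^ 2 + p.1 * p.2 + p.2 ^ 2)) * X ^ (2 * p.2 + p.1) * Y ^ (2 * p.1 + p.2)) := by
  obtain ⟨k, l⟩ := p
  unfold FF
  rw [TT_triple hq0 hX hY, EE_eq hq0]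
  simp only [Prod.mk_add_mk]
  rw [show l + d + (k + d) + (3 * d - (k + d) - (l + d)) = 3 * d by ring, neg_one_zpow_three,
    show 3 * ((l + d) ^ 2 + (k + d) ^ 2 + (3 * d - (k + d) - (l + d)) ^ 2) + 3 * d
      = (9 * d ^ 2 + 3 * d) + 6 * (k ^ 2 + k * l + l ^ 2) by ring, zpow_add₀ hq0,
    show l + d - (3 * d - (k + d) - (l + d)) = 2 * l + k by ring,
    show k + d - (3 * d - (k + d) - (l + d)) = 2 * k + l by ring]
  ring

lemma FF1 (hq0 : q ≠ 0) (hX : X ≠ 0) (hY : Y ≠ 0) (d : ℤ) (p : ℤ × ℤ) :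
    FF q X Y (3 * d + 1) (p + (d + 1, d)) = (-(-1) ^ d * q ^ (9 * d ^ 2 + 9 * d)) *
      (q ^ (3 * (p.2 ^ 2 + (p.1 + 1) ^ 2 + (p.1 + p.2) ^ 2) + 1) *
        X ^ (2 * p.2 + p.1) * Y ^ (2 * p.1 + p.2 + 1)) := by
  obtain ⟨k, l⟩ := p
  unfold FF
  rw [TT_triple hq0 hX hY]
  simp only [Prod.mk_add_mk]
  rw [show l + d + (k + (d + 1)) + (3 * d + 1 - (k + (d + 1)) - (l + d)) = 3 * d + 1 by ring,
    zpow_add₀ (by norm_num : (-1 : ℂ) ≠ 0), neg_one_zpow_three,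
    show 3 * ((l + d) ^ 2 + (k + (d + 1)) ^ 2 + (3 * d + 1 - (k + (d + 1)) - (l + d)) ^ 2)
        + (3 * d + 1)
      = (9 * d ^ 2 + 9 * d) + (3 * (l ^ 2 + (k + 1) ^ 2 + (k + l) ^ 2) + 1) by ring,
    zpow_add₀ hq0,
    show l + d - (3 * d + 1 - (k + (d + 1)) - (l + d)) = 2 * l + k by ring,
    show k + (d + 1) - (3 * d + 1 - (k + (d + 1)) - (l + d)) = 2 * k + l + 1 by ring]
  ring

lemma FF2 (hq0 : q ≠ 0) (hX : X ≠ 0) (hY : Y ≠ 0) (d : ℤ) (p : ℤ × ℤ) :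
    FF q X Y (3 * d + 2) (p + (d + 1, d + 1)) = - EE q (-(d + 1)) *
      (q ^ (6 * (p.1 ^ 2 + p.1 * p.2 + p.2 ^ 2 + p.1 + p.2) + 2) *
        X ^ (2 * p.2 + p.1 + 1) * Y ^ (2 * p.1 + p.2 + 1)) := by
  obtain ⟨k, l⟩ := p
  unfold FF
  rw [TT_triple hq0 hX hY, EE_eq hq0]
  simp only [Prod.mk_add_mk]
  rw [show l + (d + 1) + (k + (d + 1)) + (3 * d + 2 - (k + (d + 1)) - (l + (d + 1)))
      = 3 * d + 2 by ring,
    zpow_add₀ (by norm_num : (-1 : ℂ) ≠ 0), neg_one_zpow_three,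
    show 3 * ((l + (d + 1)) ^ 2 + (k + (d + 1)) ^ 2
        + (3 * d + 2 - (k + (d + 1)) - (l + (d + 1))) ^ 2) + (3 * d + 2)
      = (9 * (-(d + 1)) ^ 2 + 3 * (-(d + 1)))
        + (6 * (k ^ 2 + k * l + l ^ 2 + k + l) + 2) by ring,
    zpow_add₀ hq0,
    show l + (d + 1) - (3 * d + 2 - (k + (d + 1)) - (l + (d + 1))) = 2 * l + k + 1 by ring,
    show k + (d + 1) - (3 * d + 2 - (k + (d + 1)) - (l + (d + 1))) = 2 * k + l + 1 by ring]
  have : (-1 : ℂ) ^ (-(d + 1)) = - (-1) ^ d := by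
    rw [zpow_neg, ← inv_zpow, zpow_add₀ (by norm_num)]; norm_num
  rw [this]
  norm_num
  ring

lemma FF_summable (hq0 : q ≠ 0) (hq : ‖q‖ < 1) (hX : X ≠ 0) (hY : Y ≠ 0) :
    Summable (fun p : ℤ × (ℤ × ℤ) => FF q X Y p.1 p.2) ∧
    ∑' p : ℤ × (ℤ × ℤ), FF q X Y p.1 p.2 =
      (∑' n, TT q X n) * (∑' n, TT q Y n) * (∑' n, TT q (X * Y)⁻¹ n) := by
  have hq3 : ‖q ^ 3‖ < 1 := by
    rw [norm_pow]; exact pow_lt_one₀ (norm_nonneg q) hq three_ne_zero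
  have hs : ∀ W : ℂ, W ≠ 0 → Summable (fun n => ‖TT q W n‖) := fun W hW =>
    (summable_theta (pow_ne_zero 3 hq0) hq3 (neg_ne_zero.mpr (mul_ne_zero hq0 hW))).norm
  have sX := hs X hX
  have sY := hs Y hY
  have sZ := hs _ (inv_ne_zero (mul_ne_zero hX hY))
  have sXY := sX.mul_norm sY
  have sXYZ := summable_mul_of_summable_norm sXY sZ
  let e : ℤ × (ℤ × ℤ) ≃ (ℤ × ℤ) × ℤ :=
    { toFun := fun p => ((p.2.2, p.2.1), p.1 - p.2.1 - p.2.2)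
      invFun := fun p => (p.1.1 + p.1.2 + p.2, (p.1.2, p.1.1))
      left_inv := by rintro ⟨u, k, l⟩; simp; ring
      right_inv := by rintro ⟨⟨a, b⟩, c⟩; simp; ring }
  constructor
  · exact e.summable_iff.mpr sXYZ
  · rw [tsum_mul_tsum_of_summable_norm sX sY, tsum_mul_tsum_of_summable_norm sXY sZ,
      ← e.tsum_eq]
    rfl

lemma Bsum_zero : ∑' d : ℤ, (-(-1) ^ d * q ^ (9 * d ^ 2 + 9 * d)) = 0 := by
  have h := (Equiv.subLeft (-1 : ℤ)).tsum_eq (fun d : ℤ => (-(-1) ^ d * q ^ (9 * d ^ 2 + 9 * d)))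
  have h2 : ∀ d : ℤ, (-(-1) ^ ((Equiv.subLeft (-1 : ℤ)) d) *
      q ^ (9 * ((Equiv.subLeft (-1 : ℤ)) d) ^ 2 + 9 * ((Equiv.subLeft (-1 : ℤ)) d)) : ℂ)
      = -(-(-1) ^ d * q ^ (9 * d ^ 2 + 9 * d)) := by
    intro d
    simp only [Equiv.subLeft_apply]
    have e1 : (-1 : ℂ) ^ (-1 - d) = - (-1) ^ d := by
      rw [zpow_sub₀ (by norm_num), div_eq_mul_inv, ← inv_zpow]; norm_num
    rw [e1, show 9 * (-1 - d) ^ 2 + 9 * (-1 - d) = 9 * d ^ 2 + 9 * d by ring]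
    ring
  simp_rw [h2, tsum_neg] at h
  have := self_eq_neg.mp h.symm
  exact this

lemma key (hq0 : q ≠ 0) (hq : ‖q‖ < 1) (hX : X ≠ 0) (hY : Y ≠ 0) :
    (∑' n, TT q X n) * (∑' n, TT q Y n) * (∑' n, TT q (X * Y)⁻¹ n) =
      (∑' d, EE q d) * (AA q X Y - CC q X Y) := by
  obtain ⟨hs, ht⟩ := FF_summable hq0 hq hX hY
  rw [← ht, hs.tsum_prod, tsum_int_three hs.prod]
  have g0 : ∀ d : ℤ, ∑' p, FF q X Y (3 * d) p = EE q d * AA q X Y := by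
    intro d
    rw [← (Equiv.addRight ((d, d) : ℤ × ℤ)).tsum_eq]
    simp only [Equiv.coe_addRight, FF0 hq0 hX hY, tsum_mul_left]
    rfl
  have g1 : ∀ d : ℤ, ∑' p, FF q X Y (3 * d + 1) p =
      (-(-1) ^ d * q ^ (9 * d ^ 2 + 9 * d)) * BB q X Y := by
    intro d
    rw [← (Equiv.addRight ((d + 1, d) : ℤ × ℤ)).tsum_eq]
    simp only [Equiv.coe_addRight, FF1 hq0 hX hY, tsum_mul_left]
    rfl
  have g2 : ∀ d : ℤ, ∑' p, FF q X Y (3 * d + 2) p = - EE q (-(d + 1)) * CC q X Y := by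
    intro d
    rw [← (Equiv.addRight ((d + 1, d + 1) : ℤ × ℤ)).tsum_eq]
    simp only [Equiv.coe_addRight, FF2 hq0 hX hY, tsum_mul_left]
    rfl
  simp_rw [g0, g1, g2, tsum_mul_right, Bsum_zero, tsum_neg]
  have h := ((Equiv.addRight (1 : ℤ)).trans (Equiv.neg ℤ)).tsum_eq (EE q)
  simp only [Equiv.trans_apply, Equiv.coe_addRight, Equiv.neg_apply] at h
  rw [h]
  ring

lemma A_summable (hq0 : q ≠ 0) (hq : ‖q‖ < 1) (hX : X ≠ 0) (hY : Y ≠ 0) :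
    Summable (fun p : ℤ × ℤ =>
      q ^ (6 * (p.1 ^ 2 + p.1 * p.2 + p.2 ^ 2)) * X ^ (2 * p.2 + p.1) * Y ^ (2 * p.1 + p.2)) := by
  have h := (FF_summable hq0 hq hX hY).1.prod_factor 0
  refine h.congr fun p => ?_
  have := FF0 hq0 hX hY 0 p
  rw [EE_eq hq0] at this
  rw [← Prod.zero_eq_mk] at this
  simpa using this

lemma C_summable (hq0 : q ≠ 0) (hq : ‖q‖ < 1) (hX : X ≠ 0) (hY : Y ≠ 0) :
    Summable (fun p : ℤ × ℤ => q ^ (6 * (p.1 ^ 2 + p.1 * p.2 + p.2 ^ 2 + p.1 + p.2) + 2) *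
        X ^ (2 * p.2 + p.1 + 1) * Y ^ (2 * p.1 + p.2 + 1)) := by
  have h := ((FF_summable hq0 hq hX hY).1.prod_factor (-1)).neg
  refine h.congr fun p => ?_
  have := FF2 hq0 hX hY (-1) p
  rw [EE_eq hq0] at this
  norm_num at this
  simp only [← Prod.zero_eq_mk, add_zero] at this
  rw [this, neg_neg]

lemma E_prod (hq0 : q ≠ 0) (hq : ‖q‖ < 1) : ∑' d, EE q d = ∏' k : ℕ, (1 - q ^ (6 * k + 6)) := by
  have hq9 : ‖q ^ 9‖ < 1 := by
    rw [norm_pow]; exact pow_lt_one₀ (norm_nonneg q) hq (by norm_num)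
  have h := jtp_s13 (pow_ne_zero 9 hq0) hq9 (neg_ne_zero.mpr (pow_ne_zero 3 hq0))
  unfold EE
  rw [h]
  have hm : Multipliable (fun k : ℕ => 1 - q ^ (6 * k + 6)) := by
    simpa [sub_eq_add_neg] using mult_aux hq (-1) 6 6 (by norm_num)
  have e : ∀ k : ℕ, (1 - (q ^ 9) ^ (2 * k + 2)) * ((1 + -q ^ 3 * (q ^ 9) ^ (2 * k + 1)) *
      (1 + (-q ^ 3)⁻¹ * (q ^ 9) ^ (2 * k + 1))) =
      (1 - q ^ (6 * (3 * k) + 6)) * (1 - q ^ (6 * (3 * k + 1) + 6)) *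
        (1 - q ^ (6 * (3 * k + 2) + 6)) := by
    intro k
    have : (-q ^ 3)⁻¹ * (q ^ 9) ^ (2 * k + 1) = - q ^ (6 * (3 * k) + 6) := by
      rw [inv_neg, neg_mul, neg_inj, inv_mul_eq_iff_eq_mul₀ (pow_ne_zero 3 hq0)]
      ring
    rw [this]
    ring
  simp_rw [e]
  have m : ∀ r : ℕ, Multipliable (fun k : ℕ => 1 - q ^ (6 * (3 * k + r) + 6)) := by
    intro r
    have := mult_aux hq (-1) 18 (6 * r + 6) (by norm_num)
    refine this.congr fun k => ?_
    rw [show 6 * (3 * k + r) + 6 = 18 * k + (6 * r + 6) by ring]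
    ring
  have t1 := (((m 0).mul (m 1)).mul (m 2)).tendsto_prod_tprod_nat
  have t2 := hm.tendsto_prod_tprod_nat.comp
    (Filter.tendsto_id.const_mul_atTop' (show 0 < 3 by norm_num))
  refine tendsto_nhds_unique t1 (t2.congr fun N => ?_)
  simp only [Function.comp, id]
  induction N with
  | zero => simp
  | succ N ih =>
    rw [Finset.prod_range_succ, ← ih, show 3 * (N + 1) = 3 * N + 1 + 1 + 1 by ring,
      Finset.prod_range_succ, Finset.prod_range_succ, Finset.prod_range_succ]
    simp only [mul_assoc, add_zero]

lemma T_prod (hq0 : q ≠ 0) (hq : ‖q‖ < 1) (hX : X ≠ 0) :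
    ∑' n, TT q X n = ∏' k : ℕ, ((1 - q ^ (6 * k + 6)) *
      ((1 - q ^ (6 * k + 4) * X) * (1 - q ^ (6 * k + 2) * X⁻¹))) := by
  have hq3 : ‖q ^ 3‖ < 1 := by
    rw [norm_pow]; exact pow_lt_one₀ (norm_nonneg q) hq (by norm_num)
  have h := jtp_s13 (pow_ne_zero 3 hq0) hq3 (neg_ne_zero.mpr (mul_ne_zero hq0 hX))
  unfold TT
  rw [h]
  congr 1
  funext k
  have : (-(q * X))⁻¹ * (q ^ 3) ^ (2 * k + 1) = - (q ^ (6 * k + 2) * X⁻¹) := by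
    rw [inv_neg, neg_mul, neg_inj, mul_inv]
    rw [show (q ^ 3) ^ (2 * k + 1) = q * q ^ (6 * k + 2) by ring]
    field_simp
  rw [this]
  ring

lemma T_mult (hq : ‖q‖ < 1) (X : ℂ) :
    Multipliable (fun k : ℕ => (1 - q ^ (6 * k + 6)) *
      ((1 - q ^ (6 * k + 4) * X) * (1 - q ^ (6 * k + 2) * X⁻¹))) := by
  have m : ∀ (W : ℂ) (b : ℕ), Multipliable (fun k : ℕ => 1 - q ^ (6 * k + b) * W) := by
    intro W b
    have := mult_aux hq (-W) 6 b (by norm_num)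
    refine this.congr fun k => ?_
    ring
  have := (m 1 6).mul ((m X 4).mul (m X⁻¹ 2))
  simpa using this

lemma AC_prod (hq0 : q ≠ 0) (hq : ‖q‖ < 1) (hX : X ≠ 0) (hY : Y ≠ 0) :
    AA q X Y - CC q X Y = ∏' k : ℕ,
          (1 - q ^ (6 * k + 6)) ^ 2 *
          (1 - q ^ (6 * k + 4) * X) * (1 - q ^ (6 * k + 2) * X⁻¹) *
          (1 - q ^ (6 * k + 4) * Y) * (1 - q ^ (6 * k + 2) * Y⁻¹) *
          (1 - q ^ (6 * k + 4) * (X * Y)⁻¹) * (1 - q ^ (6 * k + 2) * (X * Y)) := by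
  have hk := key hq0 hq hX hY
  have hZ : (X * Y)⁻¹ ≠ 0 := inv_ne_zero (mul_ne_zero hX hY)
  rw [T_prod hq0 hq hX, T_prod hq0 hq hY, T_prod hq0 hq hZ, E_prod hq0 hq,
    ← (T_mult hq X).tprod_mul (T_mult hq Y),
    ← ((T_mult hq X).mul (T_mult hq Y)).tprod_mul (T_mult hq _)] at hk
  have m : ∀ (W : ℂ) (b : ℕ), Multipliable (fun k : ℕ => 1 - q ^ (6 * k + b) * W) := by
    intro W b
    have := mult_aux hq (-W) 6 b (by norm_num)
    refine this.congr fun k => ?_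
    ring
  have m6 : Multipliable (fun k : ℕ => 1 - q ^ (6 * k + 6)) := by simpa using m 1 6
  have hE : ∏' k : ℕ, (1 - q ^ (6 * k + 6)) ≠ 0 := by
    have hq6 : ‖q ^ 6‖ < 1 := by
      rw [norm_pow]; exact pow_lt_one₀ (norm_nonneg q) hq (by norm_num)
    obtain ⟨L, hL0, hL, -⟩ := PP_lim hq6
    rw [hL] at hL0
    convert hL0 using 4 with k
    rw [← pow_mul]; congr 1
  apply mul_left_cancel₀ hE
  rw [← hk]
  have mm := ((((((m6.mul m6).mul (m X 4)).mul (m X⁻¹ 2)).mul (m Y 4)).mul (m Y⁻¹ 2)).mul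
    (m (X * Y)⁻¹ 4)).mul (m (X * Y) 2)
  simp only [← sq] at mm
  rw [← m6.tprod_mul mm]
  congr 1
  funext k
  rw [inv_inv]
  ring

end main

/-- Product representation of `A(x,y|3τ) − C(x,y|3τ)`. -/
theorem A_minus_C_product (τ q : ℂ) (hτ : 0 < τ.im)
    (hq : q = Complex.exp (Real.pi * Complex.I * τ)) (x y : ℂ) :
    Afun x y (3 * τ) - Cfun x y (3 * τ)
      = ∏' k : ℕ,
          (1 - q ^ (6 * k + 6)) ^ 2 *
          (1 - q ^ (6 * k + 4) * Complex.exp (2 * Complex.I * x)) *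
          (1 - q ^ (6 * k + 2) * Complex.exp (-2 * Complex.I * x)) *
          (1 - q ^ (6 * k + 4) * Complex.exp (2 * Complex.I * y)) *
          (1 - q ^ (6 * k + 2) * Complex.exp (-2 * Complex.I * y)) *
          (1 - q ^ (6 * k + 4) * Complex.exp (-2 * Complex.I * (x + y))) *
          (1 - q ^ (6 * k + 2) * Complex.exp (2 * Complex.I * (x + y))) := by
  have hq0 : q ≠ 0 := by rw [hq]; exact Complex.exp_ne_zero _
  have hq1 : ‖q‖ < 1 := by
    rw [hq, Complex.norm_exp]
    have : (Real.pi * I * τ).re = - (Real.pi * τ.im) := by simp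
    rw [this, Real.exp_lt_one_iff]
    have := mul_pos Real.pi_pos hτ
    linarith
  have hX : cexp (2 * I * x) ≠ 0 := Complex.exp_ne_zero _
  have hY : cexp (2 * I * y) ≠ 0 := Complex.exp_ne_zero _
  have eX : cexp (-2 * I * x) = (cexp (2 * I * x))⁻¹ := by rw [← Complex.exp_neg]; congr 1; ring
  have eY : cexp (-2 * I * y) = (cexp (2 * I * y))⁻¹ := by rw [← Complex.exp_neg]; congr 1; ring
  have eZ' : cexp (2 * I * (x + y)) = cexp (2 * I * x) * cexp (2 * I * y) := by
    rw [← Complex.exp_add]; congr 1; ring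
  have eZ : cexp (-2 * I * (x + y)) = (cexp (2 * I * x) * cexp (2 * I * y))⁻¹ := by
    rw [← eZ', ← Complex.exp_neg]; congr 1; ring
  rw [eX, eY, eZ, eZ', ← AC_prod hq0 hq1 hX hY]
  congr 1
  · unfold Afun AA
    rw [(A_summable hq0 hq1 hX hY).tsum_prod]
    congr 1; funext k; congr 1; funext l
    rw [hq]
    simp only [← Complex.exp_int_mul, ← Complex.exp_add]
    congr 1
    push_cast
    ring
  · unfold Cfun CC
    rw [(C_summable hq0 hq1 hX hY).tsum_prod]
    simp_rw [← tsum_mul_left]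
    congr 1; funext k; congr 1; funext l
    rw [hq]
    simp only [← Complex.exp_int_mul, ← Complex.exp_add]
    congr 1
    push_cast
    ring
end
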